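/- The F_2-vector spaces QP_5(ω) for the weight vectors ω_(1) = (3,2,2,1), ω_(2) = (3,4,1,1) and ω_(3) = (3,4,3) of degree 23 have dimensions dim QP_5((3,2,2,1)) = 925, dim QP_5((3,4,1,1)) = 105 and dim QP_5((3,4,3)) = 24. -/

import Mathlib

open MvPolynomial

noncomputable section

/-- The polynomial algebra `P_5 = F_2[x_1,...,x_5]`. -/
abbrev P5 : Type := MvPolynomial (Fin 5) (ZMod 2)

/-- The total Steenrod square: the `F_2`-algebra endomorphism with `Sq (x_i) = x_i + x_i ^ 2`. -/
def Sq : P5 →ₐ[ZMod 2] P5 := aeval fun i => X i + X i ^ 2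

/-- `f` (homogeneous of degree `n`) is hit if it is the degree-`n` homogeneous component of
`Sq g` for some `g` all of whose homogeneous components have degree `< n`. -/
def IsHit (n : ℕ) (f : P5) : Prop :=
  ∃ g : P5, (∀ m, n ≤ m → homogeneousComponent m g = 0) ∧
    f = homogeneousComponent n (Sq g)

/-- The subspace of hit polynomials of degree `n`. -/
def hitSpan (n : ℕ) : Submodule (ZMod 2) P5 :=
  Submodule.span (ZMod 2) {f : P5 | IsHit n f}

/-- The action of `GL_5(F_2)` on `P_5` by linear substitution of the variables. -/
def actGL (g : Matrix.GeneralLinearGroup (Fin 5) (ZMod 2)) : P5 →ₐ[ZMod 2] P5 :=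
  aeval fun i => ∑ j, ((g : Matrix (Fin 5) (Fin 5) (ZMod 2)) i j) • X j

/-- `wt d i` is the `(i+1)`-st entry `ω_{i+1}` of the weight vector of the monomial with
exponent vector `d`, i.e. the number of `j` such that bit `i` of `d j` is `1`. -/
def wt (d : Fin 5 →₀ ℕ) (i : ℕ) : ℕ :=
  (Finset.univ.filter fun j : Fin 5 => Nat.testBit (d j) i).card

/-- The weight vector of the exponent vector `d` equals the (finitely supported) list `w`. -/
def hasWt (d : Fin 5 →₀ ℕ) (w : List ℕ) : Prop :=
  ∀ i, wt d i = w.getD i 0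

/-- The weight vector of `d` is strictly smaller than `w` in left lexicographic order. -/
def wtLt (d : Fin 5 →₀ ℕ) (w : List ℕ) : Prop :=
  ∃ i, (∀ j, j < i → wt d j = w.getD j 0) ∧ wt d i < w.getD i 0

/-- `P_5^-(ω)`: the span of degree-`n` monomials whose weight vector is `< w`. -/
def PMinus (n : ℕ) (w : List ℕ) : Submodule (ZMod 2) P5 :=
  Submodule.span (ZMod 2)
    {x : P5 | ∃ d : Fin 5 →₀ ℕ, x = monomial d 1 ∧ (∑ j, d j) = n ∧ wtLt d w}

/-- `P_5(ω)`: the span of degree-`n` monomials whose weight vector is `≤ w`. -/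
def PLe (n : ℕ) (w : List ℕ) : Submodule (ZMod 2) P5 :=
  Submodule.span (ZMod 2)
    {x : P5 | ∃ d : Fin 5 →₀ ℕ, x = monomial d 1 ∧ (∑ j, d j) = n ∧ (wtLt d w ∨ hasWt d w)}

/-- The monomial `x_1^a x_2^b x_3^c x_4^d x_5^e`. -/
def mon (a b c d e : ℕ) : P5 :=
  X 0 ^ a * X 1 ^ b * X 2 ^ c * X 3 ^ d * X 4 ^ e

/-- `QP_5(ω)`: the span of degree-`n` monomials of weight vector `≤ w`, modulo the hit
polynomials in that span plus `P_5^-(ω)`. -/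
abbrev QPw (n : ℕ) (w : List ℕ) :=
  ↥(PLe n w) ⧸ Submodule.comap (PLe n w).subtype ((hitSpan n ⊓ PLe n w) ⊔ PMinus n w)

/-! ### Gaussian elimination over `F_2` on rows stored as natural numbers -/

/-- Binary tries storing one natural number per leaf. -/
inductive Trie : Type
  | nil : Trie
  | leaf : ℕ → Trie
  | node : Trie → Trie → Trie

namespace Trie

def val (t : Trie) : ℕ := Trie.rec 0 (fun x => x) (fun _ _ _ _ => 0) t

/-- Eliminate a trie into its two children; written so that the kernel evaluates `t` first. -/
def split {α : Type} (t : Trie) (k : Trie → Trie → α) : α :=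
  Trie.rec (k nil nil) (fun _ => k nil nil) (fun l r _ _ => k l r) t

/-- The number stored at the leaf which is reached by the binary digits of `Nat.log2 N`. -/
def find (d : ℕ) : Trie → ℕ → ℕ :=
  Nat.rec (fun t _ => t.val) (fun d ih t N => t.split fun l r =>
    cond (Nat.beq (Nat.shiftRight N (Nat.pow 2 d)) 0) (ih l N)
      (ih r (Nat.shiftRight N (Nat.pow 2 d)))) d

/-- Store `x` at the leaf which is reached by the binary digits of `Nat.log2 N`. -/
def ins (x d : ℕ) : Trie → ℕ → Trie :=
  Nat.rec (fun _ _ => leaf x) (fun d ih t N => t.split fun l r =>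
    cond (Nat.beq (Nat.shiftRight N (Nat.pow 2 d)) 0) (node (ih l N) r)
      (node l (ih r (Nat.shiftRight N (Nat.pow 2 d))))) d

end Trie

/-- `k n`, written so that the kernel evaluates `n` first. -/
def force {α : Type} (n : ℕ) (k : ℕ → α) : α := Nat.rec (k 0) (fun m _ => k (Nat.succ m)) n

/-- Reduce the row `N` by the pivot rows in `t`; a nonzero remainder becomes a new pivot row, which
is counted in `n` if its leading position is less than `b`. -/
def insertRow (d b fuel : ℕ) : ℕ → Trie → ℕ → (Trie → ℕ → ℕ) → ℕ :=
  Nat.rec (fun _ t n k => k t n) (fun _ ih N t n k =>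
    cond (Nat.beq N 0) (k t n)
      (cond (Nat.beq (t.find d N) 0)
        (cond (Nat.beq (Nat.shiftRight N b) 0) (force (Nat.succ n) (k (t.ins N d N)))
          (k (t.ins N d N) n))
        (ih (Nat.xor N (t.find d N)) t n k))) fuel

/-- The number of leading positions less than `b` found by Gaussian elimination. -/
def rankBelow (d b : ℕ) (rows : List ℕ) : ℕ :=
  List.rec (fun _ n => n) (fun r _ ih t n => insertRow d b (2 ^ d + 1) r t n ih) rows Trie.nil 0

theorem cond_beq {α : Type} (a b : ℕ) (x y : α) :
    cond (Nat.beq a b) x y = if a = b then x else y := by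
  by_cases h : a = b
  · simp [h]
  · have hb : Nat.beq a b = false := by
      rw [Bool.eq_false_iff, Ne, Nat.beq_eq]
      exact h
    simp [h, hb]

theorem force_eq {α : Type} (n : ℕ) (k : ℕ → α) : force n k = k n := by cases n <;> rfl

/-- `h` is the position of the leading binary digit of `N`. -/
def IsLead (N h : ℕ) : Prop := N.testBit h = true ∧ ∀ i, h < i → N.testBit i = false

theorem exists_isLead {N : ℕ} (hN : N ≠ 0) : ∃ h, IsLead N h :=
  ⟨N.log2, Nat.testBit_log2 hN, fun _ hi => Nat.testBit_lt_two_pow (Nat.log2_lt hN |>.1 hi)⟩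

theorem IsLead.ne_zero {N h : ℕ} (hN : IsLead N h) : N ≠ 0 := by
  rintro rfl
  simpa using hN.1

theorem IsLead.unique {N h h' : ℕ} (hN : IsLead N h) (hN' : IsLead N h') : h = h' := by
  by_contra hne
  rcases Nat.lt_or_gt_of_ne hne with hlt | hlt
  · simpa [hN.2 _ hlt] using hN'.1
  · simpa [hN'.2 _ hlt] using hN.1

theorem IsLead.shiftRight_eq_zero {N h : ℕ} (hN : IsLead N h) (s : ℕ) :
    N >>> s = 0 ↔ h < s := by
  constructor
  · intro h0
    by_contra hlt
    have := congrArg (Nat.testBit · (h - s)) h0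
    simp [Nat.testBit_shiftRight, Nat.add_sub_cancel' (not_lt.1 hlt), hN.1] at this
  · intro hlt
    apply Nat.eq_of_testBit_eq
    intro i
    simp [Nat.testBit_shiftRight, hN.2 (s + i) (by omega)]

theorem IsLead.shiftRight {N h s : ℕ} (hN : IsLead N h) (hs : s ≤ h) :
    IsLead (N >>> s) (h - s) := by
  refine ⟨by simp [Nat.testBit_shiftRight, Nat.add_sub_cancel' hs, hN.1], fun i hi => ?_⟩
  simp [Nat.testBit_shiftRight, hN.2 (s + i) (by omega)]

theorem IsLead.lt {N h d : ℕ} (hN : IsLead N h) (hd : N < 2 ^ d) : h < d := by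
  by_contra hlt
  have := hN.1
  rw [Nat.testBit_lt_two_pow (hd.trans_le (Nat.pow_le_pow_right two_pos (not_lt.1 hlt)))] at this
  simp at this

namespace Trie

theorem find_succ (d : ℕ) (t : Trie) (N : ℕ) :
    t.find (d + 1) N = t.split fun l r =>
      if N >>> 2 ^ d = 0 then l.find d N else r.find d (N >>> 2 ^ d) := by
  simp only [← cond_beq]
  rfl

theorem ins_succ (x d : ℕ) (t : Trie) (N : ℕ) :
    t.ins x (d + 1) N = t.split fun l r =>
      if N >>> 2 ^ d = 0 then node (l.ins x d N) r else node l (r.ins x d (N >>> 2 ^ d)) := by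
  simp only [← cond_beq]
  rfl

theorem split_eq (t : Trie) :
    ∃ l r, ∀ {α : Type} (k : Trie → Trie → α), t.split k = k l r := by
  rcases t with _ | x | ⟨l, r⟩
  exacts [⟨nil, nil, fun _ => rfl⟩, ⟨nil, nil, fun _ => rfl⟩, ⟨l, r, fun _ => rfl⟩]

theorem find_eq_of_isLead {d : ℕ} {t : Trie} {N M h : ℕ} (hN : IsLead N h) (hM : IsLead M h) :
    t.find d N = t.find d M := by
  induction d generalizing t N M h with
  | zero => rfl
  | succ d ih =>
    obtain ⟨l, r, hk⟩ := t.split_eq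
    rw [find_succ, find_succ, hk, hk]
    simp only [hN.shiftRight_eq_zero, hM.shiftRight_eq_zero]
    split_ifs with hd
    · exact ih hN hM
    · exact ih (hN.shiftRight (not_lt.1 hd)) (hM.shiftRight (not_lt.1 hd))

theorem find_ins {x d : ℕ} {t : Trie} {N M h h' : ℕ} (hN : IsLead N h) (hM : IsLead M h')
    (hh : h < 2 ^ d) (hh' : h' < 2 ^ d) :
    (t.ins x d N).find d M = if h' = h then x else t.find d M := by
  induction d generalizing t N M h h' with
  | zero =>
    rw [if_pos (by omega)]
    rfl
  | succ d ih =>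
    obtain ⟨l, r, hk⟩ := t.split_eq
    rw [ins_succ, find_succ, find_succ, hk, hk]
    simp only [hN.shiftRight_eq_zero, hM.shiftRight_eq_zero]
    rw [pow_succ] at hh hh'
    by_cases hd : h < 2 ^ d <;> by_cases hd' : h' < 2 ^ d
    · simpa [hd, hd', split] using ih hN hM hd hd'
    · simp [hd, hd', split, show h' ≠ h by omega]
    · simp [hd, hd', split, show h' ≠ h by omega]
    · have key := ih (t := r) (hN.shiftRight (not_lt.1 hd)) (hM.shiftRight (not_lt.1 hd'))
        (by omega) (by omega)
      simp only [show h' - 2 ^ d = h - 2 ^ d ↔ h' = h by omega] at key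
      simpa [hd, hd', split] using key

theorem find_nil (d N : ℕ) : nil.find d N = 0 := by
  induction d generalizing N with
  | zero => rfl
  | succ d ih =>
    rw [find_succ]
    change (if _ then nil.find d N else nil.find d (N >>> 2 ^ d)) = 0
    rw [ih, ih, ite_self]

end Trie

/-- `H` consists of leading positions less than `b` of rows satisfying `P`. -/
def LeadSet (P : ℕ → Prop) (b : ℕ) (H : Finset ℕ) : Prop :=
  ∀ h ∈ H, h < b ∧ ∃ N, P N ∧ IsLead N h

theorem insertRow_succ (d b fuel N : ℕ) (t : Trie) (n : ℕ) (k : Trie → ℕ → ℕ) :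
    insertRow d b (fuel + 1) N t n k =
      if N = 0 then k t n
      else if t.find d N = 0 then
        if N >>> b = 0 then k (t.ins N d N) (n + 1) else k (t.ins N d N) n
      else insertRow d b fuel (N ^^^ t.find d N) t n k := by
  simp only [← cond_beq, ← force_eq (n + 1)]
  rfl

theorem exists_leadSet_insertRow {P : ℕ → Prop} {d b : ℕ} (hPd : ∀ N, P N → N < 2 ^ 2 ^ d)
    (hP : ∀ M N, P M → P N → P (M ^^^ N)) {fuel N n : ℕ} {t : Trie} {k : Trie → ℕ → ℕ}
    {H : Finset ℕ} (hN : P N) (hH : LeadSet P b H) (hn : H.card = n)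
    (ht : ∀ M h, IsLead M h → h < 2 ^ d → t.find d M ≠ 0 → P (t.find d M))
    (htH : ∀ M h, IsLead M h → h ∈ H → t.find d M ≠ 0)
    (hk : ∀ (t' : Trie) (n' : ℕ) (H' : Finset ℕ), LeadSet P b H' → H'.card = n' →
      (∀ M h, IsLead M h → h < 2 ^ d → t'.find d M ≠ 0 → P (t'.find d M)) →
      (∀ M h, IsLead M h → h ∈ H' → t'.find d M ≠ 0) →
      ∃ H'' : Finset ℕ, LeadSet P b H'' ∧ H''.card = k t' n') :
    ∃ H' : Finset ℕ, LeadSet P b H' ∧ H'.card = insertRow d b fuel N t n k := by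
  induction fuel generalizing N with
  | zero => exact hk t n H hH hn ht htH
  | succ fuel ih =>
    rw [insertRow_succ]
    split_ifs with h0 h1 h2
    · exact hk t n H hH hn ht htH
    · obtain ⟨h, hh⟩ := exists_isLead h0
      have hhd := hh.lt (hPd N hN)
      have hnot : h ∉ H := fun hmem => htH N h hh hmem h1
      refine hk _ _ (insert h H) ?_ (by rw [Finset.card_insert_of_notMem hnot, hn]) ?_ ?_
      · intro h' hh'
        rcases Finset.mem_insert.1 hh' with rfl | hh'
        · exact ⟨(hh.shiftRight_eq_zero b).1 h2, N, hN, hh⟩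
        · exact hH h' hh'
      · intro M h' hM hh'
        rw [Trie.find_ins hh hM hhd hh']
        split_ifs with he
        · exact fun _ => hN
        · exact ht M h' hM hh'
      · intro M h' hM hh'
        have hh'd : h' < 2 ^ d := by
          rcases Finset.mem_insert.1 hh' with rfl | hh'
          · exact hhd
          · obtain ⟨_, N', hN', hl⟩ := hH h' hh'
            exact hl.lt (hPd N' hN')
        rw [Trie.find_ins hh hM hhd hh'd]
        split_ifs with he
        · exact h0
        · exact htH M h' hM ((Finset.mem_insert.1 hh').resolve_left he)
    · obtain ⟨h, hh⟩ := exists_isLead h0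
      have hhd := hh.lt (hPd N hN)
      have hnot : h ∉ H := fun hmem => htH N h hh hmem h1
      refine hk _ _ H hH hn ?_ ?_
      · intro M h' hM hh'
        rw [Trie.find_ins hh hM hhd hh']
        split_ifs with he
        · exact fun _ => hN
        · exact ht M h' hM hh'
      · intro M h' hM hh'
        obtain ⟨_, N', hN', hl⟩ := hH h' hh'
        rw [Trie.find_ins hh hM hhd (hl.lt (hPd N' hN')), if_neg (by rintro rfl; exact hnot hh')]
        exact htH M h' hM hh'
    · obtain ⟨h, hh⟩ := exists_isLead h0
      exact ih (hP _ _ hN (ht N h hh (hh.lt (hPd N hN)) h1))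

theorem exists_leadSet_card_eq {P : ℕ → Prop} {d b : ℕ} (hPd : ∀ N, P N → N < 2 ^ 2 ^ d)
    (hP : ∀ M N, P M → P N → P (M ^^^ N)) {rows : List ℕ} (hrows : ∀ r ∈ rows, P r) :
    ∃ H : Finset ℕ, LeadSet P b H ∧ H.card = rankBelow d b rows := by
  have key : ∀ (rows : List ℕ), (∀ r ∈ rows, P r) → ∀ (t : Trie) (n : ℕ) (H : Finset ℕ),
      LeadSet P b H → H.card = n →
      (∀ M h, IsLead M h → h < 2 ^ d → t.find d M ≠ 0 → P (t.find d M)) →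
      (∀ M h, IsLead M h → h ∈ H → t.find d M ≠ 0) →
      ∃ H' : Finset ℕ, LeadSet P b H' ∧ H'.card = List.rec (motive := fun _ => Trie → ℕ → ℕ)
        (fun _ n => n) (fun r _ ih t n => insertRow d b (2 ^ d + 1) r t n ih) rows t n := by
    intro rows
    induction rows with
    | nil => exact fun _ t n H hH hn _ _ => ⟨H, hH, hn⟩
    | cons r rows ih =>
      intro hr t n H hH hn ht htH
      exact exists_leadSet_insertRow hPd hP (hr r (by simp)) hH hn ht htH
        (ih fun r' hr' => hr r' (by simp [hr']))
  refine key rows hrows Trie.nil 0 ∅ (by simp [LeadSet]) rfl ?_ (by simp)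
  intro M h _ _ h0
  exact absurd (Trie.find_nil d M) h0

/-! ### The total Steenrod square on monomials -/

/-- The coefficient of `x ^ d` in `Sq (x ^ m)`. -/
def sqCoeff (m d : Fin 5 →₀ ℕ) : ZMod 2 :=
  ∏ j, if m j ≤ d j then ((m j).choose (d j - m j) : ZMod 2) else 0

theorem prod_C_mul_X_pow (c : Fin 5 → ZMod 2) (e : Fin 5 → ℕ) :
    ∏ j, (C (c j) * X j ^ e j : P5) =
      monomial (Finsupp.equivFunOnFinite.symm e) (∏ j, c j) := by
  rw [Finset.prod_mul_distrib, ← map_prod, monomial_eq, Finsupp.prod_fintype _ _ (by simp)]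
  simp

theorem X_add_sq_pow (j : Fin 5) (m : ℕ) :
    (X j + X j ^ 2 : P5) ^ m =
      ∑ b ∈ Finset.range (m + 1), C (m.choose b : ZMod 2) * X j ^ (m + b) := by
  rw [add_comm, add_pow]
  refine Finset.sum_congr rfl fun b hb => ?_
  have hb' : b ≤ m := by simpa [Nat.lt_succ_iff] using hb
  rw [← pow_mul, ← pow_add, mul_comm, show 2 * b + (m - b) = m + b by omega]
  simp

theorem coeff_Sq (m d : Fin 5 →₀ ℕ) : coeff d (Sq (monomial m 1)) = sqCoeff m d := by
  have h1 : Sq (monomial m 1) = ∏ j, (X j + X j ^ 2 : P5) ^ m j := by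
    rw [Sq, aeval_monomial, Finsupp.prod_fintype _ _ (by simp)]
    simp
  rw [h1]
  simp_rw [X_add_sq_pow, Finset.prod_univ_sum, prod_C_mul_X_pow, coeff_sum, coeff_monomial]
  rw [sqCoeff]
  by_cases hle : ∀ j, m j ≤ d j ∧ d j - m j ≤ m j
  · rw [Finset.sum_eq_single (fun j => d j - m j)]
    · rw [if_pos]
      · exact Finset.prod_congr rfl fun j _ => by rw [if_pos (hle j).1]
      · ext j
        have := (hle j).1
        simp
        omega
    · intro p _ hp
      rw [if_neg]
      rintro rfl
      apply hp
      funext j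
      simp
    · intro hp
      refine absurd ?_ hp
      simp only [Fintype.mem_piFinset, Finset.mem_range, Nat.lt_succ_iff]
      exact fun j => (hle j).2
  · obtain ⟨j, hj⟩ := not_forall.1 hle
    rw [Finset.sum_eq_zero, Finset.prod_eq_zero (Finset.mem_univ j)]
    · split_ifs with h
      · rw [Nat.choose_eq_zero_of_lt (by omega), Nat.cast_zero]
      · rfl
    · intro p hp
      rw [if_neg]
      rintro rfl
      simp only [Fintype.mem_piFinset, Finset.mem_range, Nat.lt_succ_iff] at hp
      apply hj
      have := hp j
      simp
      omega

/-! ### Binary digits and the parity of binomial coefficients -/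

theorem land_eq_iff (a b : ℕ) : b &&& a = b ↔ b % 2 ≤ a % 2 ∧ (b / 2) &&& (a / 2) = b / 2 := by
  constructor
  · intro h
    have h0 := congrArg (· % 2) h
    have h1 := congrArg (· / 2) h
    simp only [Nat.and_div_two] at h1
    refine ⟨?_, h1⟩
    rw [← h]
    have := @Nat.and_mod_two_pow b a 1
    simp only [pow_one] at this
    rw [this]
    exact Nat.and_le_right
  · rintro ⟨h0, h1⟩
    have h2 : (b &&& a) / 2 = b / 2 := by rw [Nat.and_div_two, h1]
    have h3 : (b &&& a) % 2 = b % 2 := by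
      have := @Nat.and_mod_two_pow b a 1
      simp only [pow_one] at this
      rw [this]
      rcases Nat.mod_two_eq_zero_or_one b with hb | hb <;>
        rcases Nat.mod_two_eq_zero_or_one a with ha | ha <;> simp_all
    omega

theorem choose_cast_eq (a b : ℕ) :
    (a.choose b : ZMod 2) = if b &&& a = b then 1 else 0 := by
  induction a using Nat.strong_induction_on generalizing b with
  | _ a ih =>
    rcases Nat.eq_zero_or_pos a with rfl | ha
    · rcases b with _ | b <;> simp
    · have hl := (ZMod.natCast_eq_natCast_iff _ _ _).2
        (Choose.choose_modEq_choose_mod_mul_choose_div_nat (n := a) (k := b) (p := 2))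
      rw [hl, Nat.cast_mul, ih (a / 2) (by omega) (b / 2)]
      simp only [land_eq_iff a b]
      rcases Nat.mod_two_eq_zero_or_one b with hb | hb <;>
        rcases Nat.mod_two_eq_zero_or_one a with ha | ha <;> simp [ha, hb]

/-! ### Exponent vectors as lists -/

/-- The exponent vector with the entries of `l`. -/
def expo (l : List ℕ) : Fin 5 →₀ ℕ := Finsupp.equivFunOnFinite.symm fun j => l.getD j 0

@[simp] theorem expo_apply (l : List ℕ) (j : Fin 5) : expo l j = l.getD j 0 := rfl

theorem expo_ofFn (d : Fin 5 →₀ ℕ) : expo (List.ofFn d) = d := by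
  ext j
  fin_cases j <;> simp

theorem exists_eq_of_length {l : List ℕ} (hl : l.length = 5) :
    ∃ a b c d e, l = [a, b, c, d, e] := by
  match l, hl with
  | [a, b, c, d, e], _ => exact ⟨a, b, c, d, e, rfl⟩

theorem ofFn_expo {l : List ℕ} (hl : l.length = 5) : List.ofFn (expo l) = l := by
  obtain ⟨a, b, c, d, e, rfl⟩ := exists_eq_of_length hl
  simp

theorem sum_expo {l : List ℕ} (hl : l.length = 5) : ∑ j, expo l j = l.sum := by
  rw [← List.sum_ofFn, ofFn_expo hl]

/-- The product of the coefficients which occur in `Sq (x ^ m)`. -/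
def listCoeff (m d : List ℕ) : ZMod 2 :=
  (List.zipWith (fun a c => if a ≤ c then (a.choose (c - a) : ZMod 2) else 0) m d).prod

theorem listCoeff_eq_zero {m d : List ℕ} (hl : m.length = d.length) (h : d.sum < m.sum) :
    listCoeff m d = 0 := by
  induction m generalizing d with
  | nil => simp at h
  | cons a m ih =>
    rcases d with _ | ⟨c, d⟩
    · simp at hl
    · simp only [listCoeff, List.zipWith_cons_cons, List.prod_cons] at ih ⊢
      simp only [List.sum_cons] at h
      split_ifs with hac
      · rw [ih (by simpa using hl) (by omega), mul_zero]
      · rw [zero_mul]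

theorem sqCoeff_expo {m d : List ℕ} (hm : m.length = 5) (hd : d.length = 5) :
    sqCoeff (expo m) (expo d) = listCoeff m d := by
  obtain ⟨m0, m1, m2, m3, m4, rfl⟩ := exists_eq_of_length hm
  obtain ⟨d0, d1, d2, d3, d4, rfl⟩ := exists_eq_of_length hd
  simp [sqCoeff, listCoeff, Fin.prod_univ_five, mul_assoc]

/-- The same as `List.foldr`, in a form which the kernel evaluates faster. -/
def fold {α β : Type} (f : α → β → β) (z : β) (l : List α) : β :=
  List.rec z (fun a _ r => f a r) l

theorem fold_eq {α β : Type} (f : α → β → β) (z : β) (l : List α) : fold f z l = l.foldr f z := by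
  induction l with
  | nil => rfl
  | cons a l ih => rw [List.foldr_cons, ← ih]; rfl

/-- The numbers less than `n` whose binary digits are also digits of `a`. -/
def subdigits (a n : ℕ) : List ℕ :=
  Nat.rec [] (fun n r => cond (Nat.beq (Nat.land n a) n) (n :: r) r) n

theorem subdigits_succ (a n : ℕ) :
    subdigits a (n + 1) = if n &&& a = n then n :: subdigits a n else subdigits a n := by
  rw [← cond_beq]
  rfl

/-- The exponents of the monomials in `Sq ^ k (x ^ m)`. -/
def sqTerms (m : List ℕ) : ℕ → List (List ℕ) :=
  List.rec (fun k => cond (Nat.beq k 0) [[]] []) (fun a _ ih k =>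
    fold (fun b r => fold (fun s r => List.cons (Nat.add a b) s :: r) r (ih (Nat.sub k b))) []
      (subdigits a (Nat.succ k))) m

theorem sqTerms_nil (k : ℕ) : sqTerms [] k = if k = 0 then [[]] else [] := by
  rw [← cond_beq]
  rfl

theorem sqTerms_cons (a : ℕ) (m : List ℕ) (k : ℕ) : sqTerms (a :: m) k =
    (subdigits a (k + 1)).flatMap fun b => (sqTerms m (k - b)).map (List.cons (a + b)) := by
  change fold (fun b r => fold (fun s r => List.cons (a + b) s :: r) r (sqTerms m (k - b))) []
    (subdigits a (k + 1)) = _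
  have h : ∀ (b : ℕ) (L : List (List ℕ)) (r : List (List ℕ)),
      fold (fun s r => List.cons (a + b) s :: r) r L = L.map (List.cons (a + b)) ++ r := by
    intro b L r
    rw [fold_eq]
    induction L with
    | nil => rfl
    | cons s L ih => rw [List.foldr_cons, ih]; rfl
  simp only [h]
  induction subdigits a (k + 1) with
  | nil => rfl
  | cons b l ih => rw [List.flatMap_cons, ← ih]; rfl

theorem sum_subdigits (a n : ℕ) (f : ℕ → ZMod 2) :
    ((subdigits a n).map f).sum = ∑ b ∈ Finset.range n, if b &&& a = b then f b else 0 := by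
  induction n with
  | zero => simp [subdigits]
  | succ n ih =>
    rw [subdigits_succ, Finset.sum_range_succ, ← ih]
    split_ifs <;> simp [add_comm]

theorem count_sqTerms {m d : List ℕ} (hl : m.length = d.length) (k : ℕ) :
    ((sqTerms m k).count d : ZMod 2) = if d.sum = m.sum + k then listCoeff m d else 0 := by
  induction m generalizing d k with
  | nil =>
    obtain rfl : d = [] := List.eq_nil_of_length_eq_zero (by simpa using hl.symm)
    rw [sqTerms_nil]
    rcases Nat.eq_zero_or_pos k with rfl | hk
    · simp [listCoeff]
    · simp [hk.ne', hk.ne]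
  | cons a m ih =>
    rcases d with _ | ⟨c, d⟩
    · simp at hl
    have hl' : m.length = d.length := by simpa using hl
    rw [sqTerms_cons, List.count_flatMap, Nat.cast_list_sum, List.map_map, sum_subdigits]
    have hterm : ∀ b, ((List.map (List.cons (a + b)) (sqTerms m (k - b))).count (c :: d)
        : ZMod 2) = if a + b = c then ((sqTerms m (k - b)).count d : ZMod 2) else 0 := by
      intro b
      split_ifs with h
      · rw [h, List.count_map_of_injective _ _ (List.cons_injective)]
      · rw [List.count_eq_zero_of_not_mem, Nat.cast_zero]
        simp [h]
    simp only [Function.comp_def, hterm, ih hl']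
    have hcons : listCoeff (a :: m) (c :: d) =
        (if a ≤ c then (a.choose (c - a) : ZMod 2) else 0) * listCoeff m d := by
      simp [listCoeff]
    rw [hcons]
    by_cases hac : a ≤ c
    · rw [if_pos hac, choose_cast_eq]
      by_cases hk : c - a ≤ k
      · rw [Finset.sum_eq_single (c - a)]
        · simp only [Nat.add_sub_cancel' hac, if_true, List.sum_cons,
            show d.sum = m.sum + (k - (c - a)) ↔ c + d.sum = a + m.sum + k by omega]
          split_ifs <;> simp
        · intro b _ hb
          rw [if_neg (show ¬ a + b = c by omega), ite_self]
        · intro h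
          simp at h
          omega
      · rw [Finset.sum_eq_zero]
        · split_ifs with hs hb
          · rw [List.sum_cons, List.sum_cons] at hs
            rw [listCoeff_eq_zero hl' (by omega), mul_zero]
          · rw [zero_mul]
          · rfl
        · intro b hb
          simp at hb
          rw [if_neg (show ¬ a + b = c by omega), ite_self]
    · rw [if_neg hac, zero_mul, ite_self, Finset.sum_eq_zero]
      intro b _
      rw [if_neg (show ¬ a + b = c by omega), ite_self]

theorem length_of_mem_sqTerms {m s : List ℕ} {k : ℕ} (hs : s ∈ sqTerms m k) :
    s.length = m.length := by
  induction m generalizing s k with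
  | nil =>
    rw [sqTerms_nil] at hs
    split_ifs at hs <;> simp_all
  | cons a m ih =>
    simp only [sqTerms_cons, List.mem_flatMap, List.mem_map] at hs
    obtain ⟨b, _, s', hs', rfl⟩ := hs
    simp [ih hs']

theorem sum_of_mem_sqTerms {m s : List ℕ} {k : ℕ} (hs : s ∈ sqTerms m k) :
    s.sum = m.sum + k := by
  induction m generalizing s k with
  | nil =>
    rw [sqTerms_nil] at hs
    split_ifs at hs <;> simp_all
  | cons a m ih =>
    simp only [sqTerms_cons, List.mem_flatMap, List.mem_map] at hs
    obtain ⟨b, hb, s', hs', rfl⟩ := hs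
    have hbk : ∀ n, b ∈ subdigits a n → b < n := by
      intro n
      induction n with
      | zero => simp [subdigits]
      | succ n ihn =>
        rw [subdigits_succ]
        split_ifs
        · rw [List.mem_cons]
          rintro (h | h)
          · omega
          · have := ihn h
            omega
        · intro h
          have := ihn h
          omega
    have h1 := ih hs'
    have h2 := hbk _ hb
    rw [List.sum_cons, List.sum_cons, h1]
    change a + b + (m.sum + (k - b)) = _
    omega

theorem sum_sqTerms {m : List ℕ} (hm : m.length = 5) (k : ℕ) :
    ((sqTerms m k).map fun s => (monomial (expo s) 1 : P5)).sum =
      homogeneousComponent (m.sum + k) (Sq (monomial (expo m) 1)) := by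
  ext d
  have hcount : ∀ L : List (List ℕ), (∀ s ∈ L, s.length = 5) →
      coeff d (L.map fun s => (monomial (expo s) 1 : P5)).sum =
        (L.count (List.ofFn d) : ZMod 2) := by
    intro L hL
    induction L with
    | nil => simp
    | cons s L ih =>
      rw [List.map_cons, List.sum_cons, coeff_add, ih fun s hs => hL s (by simp [hs]),
        List.count_cons, coeff_monomial, Nat.cast_add, add_comm]
      congr 1
      by_cases h : expo s = d
      · rw [if_pos h, ← h, ofFn_expo (hL s (by simp))]
        simp
      · have : s ≠ List.ofFn d := by
          rintro rfl
          exact h (expo_ofFn d)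
        rw [if_neg h, beq_false_of_ne this]
        rfl
  rw [hcount _ fun s hs => (length_of_mem_sqTerms hs).trans hm, count_sqTerms (by simp [hm]),
    coeff_homogeneousComponent, coeff_Sq, List.sum_ofFn, Finsupp.degree_eq_sum]
  congr 1
  rw [← sqCoeff_expo hm (by simp), expo_ofFn]

theorem homogeneousComponent_Sq_mem_hitSpan {n : ℕ} {m : Fin 5 →₀ ℕ} (hm : ∑ j, m j < n) :
    homogeneousComponent n (Sq (monomial m 1)) ∈ hitSpan n := by
  refine Submodule.subset_span ⟨monomial m 1, fun k hk => ?_, rfl⟩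
  ext d
  rw [coeff_homogeneousComponent, coeff_monomial, coeff_zero]
  split_ifs with h1 h2
  · rw [Finsupp.degree_eq_sum, ← h2] at h1
    omega
  all_goals rfl

/-! ### Upper bounds -/

/-- The spread of the binary digits of `a < 32` over octal digits, the lowest digit first. -/
def spread (a : ℕ) : ℕ := Nat.land (Nat.shiftRight 445952170045471562258106931623907390963589155211215772975501181345716430173314113092031554148671300919869876728279064469822474129243148937854976 (Nat.mul 15 a)) 32767

/-- The weight vector of an exponent vector, read as an octal number. -/
def octalWeight (s : List ℕ) : ℕ := fold (fun a r => Nat.add (spread a) r) 0 s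

/-- The vector `w`, read as an octal number. -/
def octal (w : List ℕ) : ℕ := ∑ t : Fin 5, w.getD t 0 * 8 ^ (4 - (t : ℕ))

theorem spread_eq {a : ℕ} (ha : a < 32) :
    spread a = ∑ t : Fin 5, (a.testBit t).toNat * 8 ^ (4 - (t : ℕ)) := by
  have h : ∀ a < 32, spread a = (a.testBit 0).toNat * 4096 + (a.testBit 1).toNat * 512 +
      (a.testBit 2).toNat * 64 + (a.testBit 3).toNat * 8 + (a.testBit 4).toNat := by
    decide +kernel
  rw [h a ha]
  simp [Fin.sum_univ_five]

theorem wt_eq (d : Fin 5 →₀ ℕ) (i : ℕ) : wt d i = ∑ j, ((d j).testBit i).toNat := by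
  rw [wt, Finset.card_filter]
  refine Finset.sum_congr rfl fun j _ => ?_
  cases (d j).testBit i <;> rfl

theorem wt_le (d : Fin 5 →₀ ℕ) (i : ℕ) : wt d i ≤ 5 :=
  (Finset.card_filter_le _ _).trans (by simp)

theorem octalWeight_eq {s : List ℕ} (hl : s.length = 5) (hs : ∀ a ∈ s, a < 32) :
    octalWeight s = ∑ t : Fin 5, wt (expo s) t * 8 ^ (4 - (t : ℕ)) := by
  obtain ⟨a, b, c, d, e, rfl⟩ := exists_eq_of_length hl
  simp only [List.mem_cons, List.not_mem_nil, or_false, forall_eq_or_imp, forall_eq] at hs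
  obtain ⟨ha, hb, hc, hd, he⟩ := hs
  change spread a + (spread b + (spread c + (spread d + (spread e + 0)))) = _
  rw [spread_eq ha, spread_eq hb, spread_eq hc, spread_eq hd, spread_eq he]
  simp only [wt_eq, Fin.sum_univ_five, expo_apply]
  simp
  ring

/-- Left lexicographic order. -/
def LexLt (f g : ℕ → ℕ) : Prop := ∃ i, (∀ j, j < i → f j = g j) ∧ f i < g i

theorem LexLt.trans {f g h : ℕ → ℕ} (hfg : LexLt f g) (hgh : LexLt g h) : LexLt f h := by
  obtain ⟨i, hi, hi'⟩ := hfg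
  obtain ⟨k, hk, hk'⟩ := hgh
  rcases lt_trichotomy i k with hik | rfl | hik
  · exact ⟨i, fun j hj => (hi j hj).trans (hk j (hj.trans hik)), by rwa [← hk i hik]⟩
  · exact ⟨i, fun j hj => (hi j hj).trans (hk j hj), hi'.trans hk'⟩
  · exact ⟨k, fun j hj => (hi j (hj.trans hik)).trans (hk j hj), by rwa [hi k hik]⟩

theorem lexLt_of_octal_lt {f g : ℕ → ℕ} (hf : ∀ i, f i < 8) (hg : ∀ i, g i < 8)
    (h : ∑ t : Fin 5, f t * 8 ^ (4 - (t : ℕ)) < ∑ t : Fin 5, g t * 8 ^ (4 - (t : ℕ))) :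
    LexLt f g := by
  simp [Fin.sum_univ_five] at h
  have h0 := hf 0
  have h1 := hf 1
  have h2 := hf 2
  have h3 := hf 3
  have h4 := hf 4
  have h0' := hg 0
  have h1' := hg 1
  have h2' := hg 2
  have h3' := hg 3
  have h4' := hg 4
  rcases lt_trichotomy (f 0) (g 0) with e0 | e0 | e0
  · exact ⟨0, by simp, e0⟩
  · rcases lt_trichotomy (f 1) (g 1) with e1 | e1 | e1
    · exact ⟨1, by intro j hj; interval_cases j; exact e0, e1⟩
    · rcases lt_trichotomy (f 2) (g 2) with e2 | e2 | e2
      · exact ⟨2, by intro j hj; interval_cases j <;> assumption, e2⟩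
      · rcases lt_trichotomy (f 3) (g 3) with e3 | e3 | e3
        · exact ⟨3, by intro j hj; interval_cases j <;> assumption, e3⟩
        · exact ⟨4, by intro j hj; interval_cases j <;> assumption, by omega⟩
        · omega
      · omega
    · omega
  · omega

theorem eq_of_octal_eq {f g : ℕ → ℕ} (hf : ∀ i, f i < 8) (hg : ∀ i, g i < 8)
    (h : ∑ t : Fin 5, f t * 8 ^ (4 - (t : ℕ)) = ∑ t : Fin 5, g t * 8 ^ (4 - (t : ℕ))) {i : ℕ}
    (hi : i < 5) : f i = g i := by
  simp [Fin.sum_univ_five] at h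
  have h0 := hf 0
  have h1 := hf 1
  have h2 := hf 2
  have h3 := hf 3
  have h4 := hf 4
  have h0' := hg 0
  have h1' := hg 1
  have h2' := hg 2
  have h3' := hg 3
  have h4' := hg 4
  interval_cases i <;> omega

theorem wt_expo_eq_zero {s : List ℕ} {n : ℕ} (hs : ∀ a ∈ s, a < 2 ^ n) {i : ℕ} (hi : n ≤ i) :
    wt (expo s) i = 0 := by
  rw [wt_eq]
  refine Finset.sum_eq_zero fun j _ => ?_
  have : expo s j < 2 ^ i := by
    rw [expo_apply]
    rcases lt_or_ge (j : ℕ) s.length with hj | hj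
    · rw [List.getD_eq_getElem _ _ hj]
      exact (hs _ (List.getElem_mem hj)).trans_le (Nat.pow_le_pow_right two_pos hi)
    · rw [List.getD_eq_default _ _ hj]
      positivity
  rw [Nat.testBit_lt_two_pow this]
  rfl

/-- A weight vector of length at most five with entries less than eight. -/
def SmallWt (w : List ℕ) : Prop := w.length ≤ 5 ∧ ∀ a ∈ w, a < 8

theorem SmallWt.getD_lt {w : List ℕ} (hw : SmallWt w) (i : ℕ) : w.getD i 0 < 8 := by
  rcases lt_or_ge i w.length with hi | hi
  · rw [List.getD_eq_getElem _ _ hi]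
    exact hw.2 _ (List.getElem_mem hi)
  · rw [List.getD_eq_default _ _ hi]
    norm_num

theorem wtLt_of_octalWeight_lt {s w : List ℕ} (hl : s.length = 5) (hs : ∀ a ∈ s, a < 32)
    (hw : SmallWt w) (h : octalWeight s < octal w) : wtLt (expo s) w := by
  rw [octalWeight_eq hl hs] at h
  exact lexLt_of_octal_lt (g := fun i => w.getD i 0)
    (fun i => (wt_le _ i).trans_lt (by norm_num)) hw.getD_lt h

theorem lexLt_of_lt_octalWeight {s w : List ℕ} (hl : s.length = 5) (hs : ∀ a ∈ s, a < 32)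
    (hw : SmallWt w) (h : octal w < octalWeight s) :
    LexLt (fun i => w.getD i 0) (wt (expo s)) := by
  rw [octalWeight_eq hl hs] at h
  exact lexLt_of_octal_lt (f := fun i => w.getD i 0) hw.getD_lt
    (fun i => (wt_le _ i).trans_lt (by norm_num)) h

theorem hasWt_of_octalWeight_eq {s w : List ℕ} (hl : s.length = 5) (hs : ∀ a ∈ s, a < 32)
    (hw : SmallWt w) (h : octalWeight s = octal w) : hasWt (expo s) w := by
  rw [octalWeight_eq hl hs] at h
  intro i
  rcases lt_or_ge i 5 with hi | hi
  · exact eq_of_octal_eq (g := fun i => w.getD i 0) (fun i => (wt_le _ i).trans_lt (by norm_num))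
      hw.getD_lt h hi
  · rw [wt_expo_eq_zero (n := 5) hs hi, List.getD_eq_default _ _ (hw.1.trans hi)]

/-- A number which determines the exponents of a monomial of degree 23. -/
def code (s : List ℕ) : ℕ := fold (fun a r => Nat.add a (Nat.mul 16 r)) 0 s

/-- The exponents of the monomial of degree 23 with code `c < 65536`. -/
def decode (c : ℕ) : List ℕ :=
  [c % 16, c / 16 % 16, c / 256 % 16, c / 4096 % 16,
    23 - (c % 16 + c / 16 % 16 + c / 256 % 16 + c / 4096 % 16)]

/-- Whether all exponents are less than 16, unless the weight is less than `W`. -/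
def smallTerm (W : ℕ) (s : List ℕ) : Bool :=
  cond (Nat.blt (octalWeight s) W) true (Nat.blt (fold Nat.lor 0 s) 16)

/-- The sum of the monomials of weight at least `W`; those of weight greater than `W` have
positions above 65536. -/
def termSum (W : ℕ) (L : List (List ℕ)) : ℕ :=
  fold (fun s r => cond (Nat.blt (octalWeight s) W) r
    (Nat.xor r (Nat.shiftLeft 1 (Nat.add (Nat.mod (code s) 65536)
      (cond (Nat.beq (octalWeight s) W) 0 65536))))) 0 L

/-- The row of the hit polynomial `Sq ^ k (x ^ m)` of degree 23 modulo monomials of weight less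
than `W`. -/
def hitRow (W k : ℕ) (m : List ℕ) : ℕ :=
  cond (Nat.blt 0 k && Nat.beq m.length 5 && Nat.beq (Nat.add m.sum k) 23 &&
    fold (fun s r => cond (smallTerm W s) r false) true (sqTerms m k)) (termSum W (sqTerms m k)) 0

/-- The value of a binary digit as an element of `F_2`. -/
def bit (N i : ℕ) : ZMod 2 := ((N.testBit i).toNat : ZMod 2)

theorem bit_xor (M N i : ℕ) : bit (M ^^^ N) i = bit M i + bit N i := by
  rw [bit, bit, bit, Nat.testBit_xor]
  cases M.testBit i <;> cases N.testBit i <;> decide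

theorem bit_zero (i : ℕ) : bit 0 i = 0 := by simp [bit]

/-- The polynomial represented by a row. -/
def rowPoly (N : ℕ) : P5 :=
  ∑ c ∈ Finset.range (2 ^ 17), monomial (expo (decode (c % 65536))) (bit N c)

theorem rowPoly_xor (M N : ℕ) : rowPoly (M ^^^ N) = rowPoly M + rowPoly N := by
  simp only [rowPoly, bit_xor, map_add, Finset.sum_add_distrib]

theorem rowPoly_shiftLeft {i : ℕ} (hi : i < 2 ^ 17) :
    rowPoly (1 <<< i) = monomial (expo (decode (i % 65536))) 1 := by
  rw [rowPoly, Finset.sum_eq_single i]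
  · simp [bit]
  · intro c _ hc
    have : (1 <<< i).testBit c = false := by
      rw [Nat.one_shiftLeft, Nat.testBit_two_pow_of_ne hc.symm]
    simp [bit, this]
  · exact fun h => absurd (Finset.mem_range.2 hi) h

/-- `N` is a relation between monomials of weight `w` modulo hit polynomials and monomials of
smaller weight. -/
def IsRel (w : List ℕ) (N : ℕ) : Prop :=
  N < 2 ^ 2 ^ 17 ∧ rowPoly N ∈ hitSpan 23 ⊔ PMinus 23 w ∧
    ∀ c < 65536, N.testBit c = true → (decode c).sum = 23 ∧ hasWt (expo (decode c)) w

theorem isRel_xor {w : List ℕ} {M N : ℕ} (hM : IsRel w M) (hN : IsRel w N) :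
    IsRel w (M ^^^ N) := by
  refine ⟨Nat.xor_lt_two_pow hM.1 hN.1, ?_, fun c hc h => ?_⟩
  · rw [rowPoly_xor]
    exact add_mem hM.2.1 hN.2.1
  · rw [Nat.testBit_xor] at h
    cases hb : M.testBit c with
    | true => exact hM.2.2 c hc hb
    | false => exact hN.2.2 c hc (by simpa [hb] using h)

theorem decode_code {s : List ℕ} (hl : s.length = 5) (hs : ∀ a ∈ s, a < 16) (hsum : s.sum = 23) :
    decode (code s % 65536) = s := by
  obtain ⟨a, b, c, d, e, rfl⟩ := exists_eq_of_length hl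
  simp only [List.mem_cons, List.not_mem_nil, or_false, forall_eq_or_imp, forall_eq] at hs
  simp only [List.sum_cons, List.sum_nil] at hsum
  change decode ((a + 16 * (b + 16 * (c + 16 * (d + 16 * (e + 16 * 0))))) % 65536) = _
  have h : (a + 16 * (b + 16 * (c + 16 * (d + 16 * (e + 16 * 0))))) % 65536 =
      a + 16 * b + 256 * c + 4096 * d := by omega
  have h1 : (a + 16 * b + 256 * c + 4096 * d) / 16 = b + 16 * c + 256 * d := by omega
  have h2 : (a + 16 * b + 256 * c + 4096 * d) / 256 = c + 16 * d := by omega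
  have h3 : (a + 16 * b + 256 * c + 4096 * d) / 4096 = d := by omega
  rw [h, decode, h1, h2, h3, show (a + 16 * b + 256 * c + 4096 * d) % 16 = a by omega,
    show (b + 16 * c + 256 * d) % 16 = b by omega, show (c + 16 * d) % 16 = c by omega,
    show d % 16 = d by omega, show 23 - (a + b + c + d) = e by omega]

theorem code_decode {c : ℕ} (hc : c < 65536) : code (decode c) % 65536 = c := by
  change (c % 16 + 16 * (c / 16 % 16 + 16 * (c / 256 % 16 + 16 * (c / 4096 % 16 + 16 *
    (_ + 16 * 0))))) % 65536 = c
  omega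

theorem le_fold_lor {s : List ℕ} {a : ℕ} (ha : a ∈ s) :
    a ≤ fold Nat.lor 0 s := by
  induction s with
  | nil => simp at ha
  | cons b s ih =>
    change a ≤ b ||| fold Nat.lor 0 s
    rcases List.mem_cons.1 ha with rfl | ha
    · exact Nat.left_le_or
    · exact (ih ha).trans Nat.right_le_or

theorem monomial_mem_PMinus {n : ℕ} {w s : List ℕ} (hl : s.length = 5) (hsum : s.sum = n)
    (h : wtLt (expo s) w) : monomial (expo s) 1 ∈ PMinus n w :=
  Submodule.subset_span ⟨expo s, rfl, by rw [sum_expo hl, hsum], h⟩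

theorem termSum_cons (W : ℕ) (s : List ℕ) (L : List (List ℕ)) :
    termSum W (s :: L) = if octalWeight s < W then termSum W L else termSum W L ^^^
      (1 <<< (code s % 65536 + if octalWeight s = W then 0 else 65536)) := by
  rw [← cond_beq]
  by_cases h : octalWeight s < W
  · rw [if_pos h]
    change cond (Nat.blt (octalWeight s) W) _ _ = _
    rw [show Nat.blt (octalWeight s) W = true from Nat.ble_eq_true_of_le h]
    rfl
  · rw [if_neg h]
    change cond (Nat.blt (octalWeight s) W) _ _ = _
    rw [show Nat.blt (octalWeight s) W = false from
      Bool.eq_false_iff.2 fun h' => h (Nat.le_of_ble_eq_true h')]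
    rfl

theorem termSum_spec {w : List ℕ} (hw : SmallWt w) {L : List (List ℕ)}
    (hlen : ∀ s ∈ L, s.length = 5) (hsum : ∀ s ∈ L, s.sum = 23)
    (hsmall : ∀ s ∈ L, smallTerm (octal w) s = true) :
    termSum (octal w) L < 2 ^ 2 ^ 17 ∧
    rowPoly (termSum (octal w) L) - (L.map fun s => (monomial (expo s) 1 : P5)).sum ∈
      PMinus 23 w ∧
    ∀ c < 65536, (termSum (octal w) L).testBit c = true →
      (decode c).sum = 23 ∧ hasWt (expo (decode c)) w := by
  induction L with
  | nil =>
    rw [show termSum (octal w) [] = 0 from rfl]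
    exact ⟨Nat.two_pow_pos _, by simp [rowPoly, bit_zero], by simp⟩
  | cons s L ih =>
    obtain ⟨ih1, ih2, ih3⟩ := ih (fun s hs => hlen s (by simp [hs]))
      (fun s hs => hsum s (by simp [hs])) (fun s hs => hsmall s (by simp [hs]))
    have hl := hlen s (by simp)
    have hs := hsum s (by simp)
    have h32 : ∀ a ∈ s, a < 32 := fun a ha => by
      have := List.le_sum_of_mem ha
      omega
    have hsm := hsmall s (by simp)
    rw [termSum_cons, List.map_cons, List.sum_cons]
    split_ifs with h1 h2
    · refine ⟨ih1, ?_, ih3⟩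
      rw [← sub_sub, sub_right_comm]
      exact sub_mem ih2 (monomial_mem_PMinus hl hs (wtLt_of_octalWeight_lt hl h32 hw h1))
    all_goals
      have h16 : ∀ a ∈ s, a < 16 := fun a ha => by
        rw [smallTerm, show Nat.blt (octalWeight s) (octal w) = false from
          Bool.eq_false_iff.2 fun h' => h1 (Nat.le_of_ble_eq_true h')] at hsm
        exact (le_fold_lor ha).trans_lt (Nat.le_of_ble_eq_true hsm)
      have hdec := decode_code hl h16 hs
      have hmod : code s % 65536 < 65536 := Nat.mod_lt _ (by norm_num)
    · refine ⟨Nat.xor_lt_two_pow ih1 ?_, ?_, ?_⟩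
      · rw [Nat.one_shiftLeft]
        exact Nat.pow_lt_pow_right (by norm_num) (by omega)
      · rw [rowPoly_xor, rowPoly_shiftLeft (by omega), add_zero, Nat.mod_mod, hdec, add_comm,
          add_sub_add_left_eq_sub]
        exact ih2
      · intro c hc hbit
        rw [Nat.testBit_xor] at hbit
        by_cases hcs : c = code s % 65536
        · rw [hcs, hdec]
          exact ⟨hs, hasWt_of_octalWeight_eq hl h32 hw h2⟩
        · rw [Nat.one_shiftLeft, Nat.testBit_two_pow_of_ne (by omega)] at hbit
          exact ih3 c hc (by simpa using hbit)
    · refine ⟨Nat.xor_lt_two_pow ih1 ?_, ?_, ?_⟩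
      · rw [Nat.one_shiftLeft]
        exact Nat.pow_lt_pow_right (by norm_num) (by omega)
      · rw [rowPoly_xor, rowPoly_shiftLeft (by omega), Nat.add_mod_right, Nat.mod_mod, hdec,
          add_comm, add_sub_add_left_eq_sub]
        exact ih2
      · intro c hc hbit
        rw [Nat.testBit_xor, Nat.one_shiftLeft, Nat.testBit_two_pow_of_ne (by omega)] at hbit
        exact ih3 c hc (by simpa using hbit)

theorem isRel_hitRow {w : List ℕ} (hw : SmallWt w) (k : ℕ) (m : List ℕ) :
    IsRel w (hitRow (octal w) k m) := by
  have hall : ∀ L : List (List ℕ), fold (fun s r => cond (smallTerm (octal w) s) r false) true L =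
      L.all (smallTerm (octal w)) := by
    intro L
    rw [fold_eq]
    induction L with
    | nil => rfl
    | cons s L ih => rw [List.foldr_cons, ih, List.all_cons]; cases smallTerm (octal w) s <;> rfl
  rw [hitRow, hall]
  cases hc : (Nat.blt 0 k && Nat.beq m.length 5 && Nat.beq (Nat.add m.sum k) 23 &&
    (sqTerms m k).all (smallTerm (octal w))) with
  | false => exact ⟨Nat.two_pow_pos _, by simp [rowPoly, bit_zero], by simp⟩
  | true =>
    simp only [Bool.and_eq_true, Nat.beq_eq, List.all_eq_true] at hc
    obtain ⟨⟨⟨hk, hlen⟩, hsum⟩, hsmall⟩ := hc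
    change m.sum + k = 23 at hsum
    have hk : 0 < k := Nat.le_of_ble_eq_true hk
    obtain ⟨h1, h2, h3⟩ := termSum_spec hw (fun s hs => (length_of_mem_sqTerms hs).trans hlen)
      (fun s hs => (sum_of_mem_sqTerms hs).trans hsum) hsmall
    refine ⟨h1, ?_, h3⟩
    rw [sum_sqTerms hlen, hsum] at h2
    have h4 : homogeneousComponent 23 (Sq (monomial (expo m) 1)) ∈ hitSpan 23 :=
      homogeneousComponent_Sq_mem_hitSpan (by rw [sum_expo hlen]; omega)
    have := add_mem (Submodule.mem_sup_right (S := hitSpan 23) h2)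
      (Submodule.mem_sup_left (T := PMinus 23 w) h4)
    simpa using this

/-! ### The monomials of a given weight -/

/-- The lists of length `n` with `w` entries `1` and all other entries `0`. -/
def bitLists : ℕ → ℕ → List (List ℕ)
  | 0, w => cond (Nat.beq w 0) [[]] []
  | n + 1, 0 => (bitLists n 0).map (List.cons 0)
  | n + 1, w + 1 => (bitLists n (w + 1)).map (List.cons 0) ++ (bitLists n w).map (List.cons 1)

/-- Append the binary digits `b` to the numbers in `s`. -/
def double (s b : List ℕ) : List ℕ := List.zipWith (fun a c => Nat.add (Nat.mul 2 a) c) s b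

/-- The exponents of the monomials of weight `w`. -/
def fam : List ℕ → List (List ℕ)
  | [] => [[0, 0, 0, 0, 0]]
  | w :: ws => (bitLists 5 w).flatMap fun b => (fam ws).map fun s => double s b

theorem mem_bitLists {n w : ℕ} {b : List ℕ} :
    b ∈ bitLists n w ↔ b.length = n ∧ (∀ a ∈ b, a < 2) ∧ b.sum = w := by
  induction n generalizing w b with
  | zero =>
    rw [bitLists, cond_beq, List.length_eq_zero_iff]
    constructor
    · split_ifs with h
      · simp +contextual [h]
      · simp
    · rintro ⟨rfl, -, h⟩
      simp [← h]
  | succ n ih =>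
    rcases b with _ | ⟨a, b⟩
    · cases w <;> simp [bitLists]
    · cases w with
      | zero =>
        simp only [bitLists, List.mem_map, List.cons.injEq, exists_eq_right_right, ih,
          List.length_cons, List.mem_cons, forall_eq_or_imp, List.sum_cons,
          Nat.add_right_cancel_iff]
        constructor
        · rintro ⟨h, rfl⟩
          exact ⟨h.1, ⟨by norm_num, h.2.1⟩, by omega⟩
        · rintro ⟨h1, ⟨h2, h3⟩, h4⟩
          exact ⟨⟨h1, h3, by omega⟩, by omega⟩
      | succ w =>
        simp only [bitLists, List.mem_append, List.mem_map, List.cons.injEq, exists_eq_right_right,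
          ih, List.length_cons, List.mem_cons, forall_eq_or_imp, List.sum_cons,
          Nat.add_right_cancel_iff]
        constructor
        · rintro (⟨h, rfl⟩ | ⟨h, rfl⟩)
          · exact ⟨h.1, ⟨by norm_num, h.2.1⟩, by omega⟩
          · exact ⟨h.1, ⟨by norm_num, h.2.1⟩, by omega⟩
        · rintro ⟨h1, ⟨h2, h3⟩, h4⟩
          obtain rfl | rfl : a = 0 ∨ a = 1 := by omega
          · exact Or.inl ⟨⟨h1, h3, by omega⟩, rfl⟩
          · exact Or.inr ⟨⟨h1, h3, by omega⟩, rfl⟩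

theorem double_map (s : List ℕ) : double (s.map (· / 2)) (s.map (· % 2)) = s := by
  induction s with
  | nil => rfl
  | cons a s ih =>
    simp only [double, List.map_cons, List.zipWith_cons_cons, List.cons.injEq] at ih ⊢
    exact ⟨Nat.div_add_mod a 2, ih⟩

theorem map_div_double {s b : List ℕ} (hl : s.length = b.length) (hb : ∀ c ∈ b, c < 2) :
    (double s b).map (· / 2) = s := by
  induction s generalizing b with
  | nil => rfl
  | cons a s ih =>
    rcases b with _ | ⟨c, b⟩
    · simp at hl
    have hc := hb c (by simp)
    simp only [double, List.map_cons, List.zipWith_cons_cons, List.cons.injEq] at ih ⊢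
    refine ⟨?_, ih (by simpa using hl) fun c hc => hb c (by simp [hc])⟩
    change (2 * a + c) / 2 = a
    omega

theorem map_mod_double {s b : List ℕ} (hl : s.length = b.length) (hb : ∀ c ∈ b, c < 2) :
    (double s b).map (· % 2) = b := by
  induction s generalizing b with
  | nil => exact (List.eq_nil_of_length_eq_zero hl.symm).symm
  | cons a s ih =>
    rcases b with _ | ⟨c, b⟩
    · simp at hl
    have hc := hb c (by simp)
    simp only [double, List.map_cons, List.zipWith_cons_cons, List.cons.injEq] at ih ⊢
    refine ⟨?_, ih (by simpa using hl) fun c hc => hb c (by simp [hc])⟩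
    change (2 * a + c) % 2 = c
    omega

theorem wt_expo {s : List ℕ} (hl : s.length = 5) (i : ℕ) :
    wt (expo s) i = (s.map fun a => (a.testBit i).toNat).sum := by
  obtain ⟨a, b, c, d, e, rfl⟩ := exists_eq_of_length hl
  simp [wt_eq, Fin.sum_univ_five, add_assoc]

theorem wt_expo_zero {s : List ℕ} (hl : s.length = 5) : wt (expo s) 0 = (s.map (· % 2)).sum := by
  rw [wt_expo hl]
  congr 2
  ext a
  simp [Nat.testBit_zero]
  rcases Nat.mod_two_eq_zero_or_one a with h | h <;> simp [h]

theorem wt_expo_succ {s : List ℕ} (hl : s.length = 5) (i : ℕ) :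
    wt (expo s) (i + 1) = wt (expo (s.map (· / 2))) i := by
  rw [wt_expo hl, wt_expo (by simpa using hl), List.map_map]
  simp [Function.comp_def, Nat.testBit_succ]

theorem mem_fam {ws s : List ℕ} : s ∈ fam ws ↔ s.length = 5 ∧ hasWt (expo s) ws := by
  induction ws generalizing s with
  | nil =>
    rw [fam, List.mem_singleton]
    constructor
    · rintro rfl
      exact ⟨rfl, fun i => by simp [wt_expo]⟩
    · rintro ⟨hl, h⟩
      have hz : ∀ a ∈ s, a = 0 := by
        intro a ha
        apply Nat.eq_of_testBit_eq
        intro i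
        have := h i
        rw [wt_expo hl, List.getD_nil, List.sum_eq_zero_iff] at this
        simpa using this _ (List.mem_map_of_mem ha)
      obtain ⟨a, b, c, d, e, rfl⟩ := exists_eq_of_length hl
      simpa using hz
  | cons w ws ih =>
    simp only [fam, List.mem_flatMap, List.mem_map, ih, mem_bitLists]
    constructor
    · rintro ⟨b, ⟨hb, hb2, hbs⟩, s, ⟨hs, hsw⟩, rfl⟩
      have hl : (double s b).length = 5 := by simp [double, hs, hb]
      refine ⟨hl, fun i => ?_⟩
      cases i with
      | zero => rw [wt_expo_zero hl, map_mod_double (by omega) hb2, hbs]; rfl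
      | succ i => rw [wt_expo_succ hl, map_div_double (by omega) hb2, hsw i]; rfl
    · rintro ⟨hl, h⟩
      refine ⟨s.map (· % 2), ⟨by simpa using hl, fun a ha => ?_, ?_⟩, s.map (· / 2),
        ⟨by simpa using hl, fun i => ?_⟩, double_map s⟩
      · obtain ⟨c, -, rfl⟩ := List.mem_map.1 ha
        exact Nat.mod_lt c two_pos
      · rw [← wt_expo_zero hl, h 0]; rfl
      · rw [← wt_expo_succ hl, h (i + 1)]; rfl

theorem sum_double {s b : List ℕ} (hl : s.length = b.length) :
    (double s b).sum = 2 * s.sum + b.sum := by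
  induction s generalizing b with
  | nil => rw [List.eq_nil_of_length_eq_zero hl.symm]; rfl
  | cons a s ih =>
    rcases b with _ | ⟨c, b⟩
    · simp at hl
    simp only [double, List.zipWith_cons_cons, List.sum_cons] at ih ⊢
    rw [ih (by simpa using hl)]
    change 2 * a + c + _ = _
    ring

theorem length_of_mem_fam {ws s : List ℕ} (hs : s ∈ fam ws) : s.length = 5 := (mem_fam.1 hs).1

theorem sum_of_mem_fam {ws s : List ℕ} (hs : s ∈ fam ws) : s.sum = Nat.ofDigits 2 ws := by
  induction ws generalizing s with
  | nil =>
    rw [fam, List.mem_singleton] at hs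
    subst hs
    rfl
  | cons w ws ih =>
    simp only [fam, List.mem_flatMap, List.mem_map] at hs
    obtain ⟨b, hb, s, hs, rfl⟩ := hs
    obtain ⟨hb1, hb2, hb3⟩ := mem_bitLists.1 hb
    rw [sum_double (by rw [length_of_mem_fam hs, hb1]), ih hs, hb3, Nat.ofDigits_cons, add_comm]

theorem lt_of_mem_fam {ws s : List ℕ} (hs : s ∈ fam ws) : ∀ a ∈ s, a < 2 ^ ws.length := by
  induction ws generalizing s with
  | nil =>
    rw [fam, List.mem_singleton] at hs
    subst hs
    simp
  | cons w ws ih =>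
    simp only [fam, List.mem_flatMap, List.mem_map] at hs
    obtain ⟨b, hb, s, hs, rfl⟩ := hs
    obtain ⟨hb1, hb2, hb3⟩ := mem_bitLists.1 hb
    intro a ha
    have hdiv := map_div_double (s := s) (b := b) (by rw [length_of_mem_fam hs, hb1]) hb2
    have := ih hs (a / 2) (hdiv ▸ List.mem_map_of_mem ha)
    rw [List.length_cons, pow_succ]
    omega

/-- The rows of the hit polynomials `Sq ^ k (x ^ m)` for `m` of weight `v` and `(k, v)` in `ts`. -/
def hitRows (W : ℕ) (ts : List (ℕ × List ℕ)) : List ℕ :=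
  ts.flatMap fun t => (fam t.2).map (hitRow W t.1)

theorem isRel_of_mem_hitRows {w : List ℕ} (hw : SmallWt w) (ts : List (ℕ × List ℕ)) :
    ∀ r ∈ hitRows (octal w) ts, IsRel w r := by
  intro r hr
  simp only [hitRows, List.mem_flatMap, List.mem_map] at hr
  obtain ⟨t, _, m, _, rfl⟩ := hr
  exact isRel_hitRow hw _ _

theorem PMinus_le_PLe (n : ℕ) (w : List ℕ) : PMinus n w ≤ PLe n w :=
  Submodule.span_mono fun _ ⟨d, hx, hd, h⟩ => ⟨d, hx, hd, Or.inl h⟩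

theorem monomial_mem_PLe {w s : List ℕ} (hs : s ∈ fam w) :
    monomial (expo s) 1 ∈ PLe (Nat.ofDigits 2 w) w :=
  Submodule.subset_span ⟨expo s, rfl, by rw [sum_expo (length_of_mem_fam hs), sum_of_mem_fam hs],
    Or.inr (mem_fam.1 hs).2⟩

/-- A set of monomials which spans modulo hit polynomials and smaller monomials bounds the
dimension. -/
theorem finrank_QPw_le {n : ℕ} {w : List ℕ} {B : Finset P5} (hB : ∀ b ∈ B, b ∈ PLe n w)
    (hspan : PLe n w ≤ Submodule.span (ZMod 2) B ⊔ (hitSpan n ⊔ PMinus n w)) :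
    Module.Finite (ZMod 2) (QPw n w) ∧ Module.finrank (ZMod 2) (QPw n w) ≤ B.card := by
  have hV : Submodule.span (ZMod 2) (B : Set P5) ≤ PLe n w := Submodule.span_le.2 hB
  let f : Submodule.span (ZMod 2) (B : Set P5) →ₗ[ZMod 2] QPw n w :=
    (Submodule.mkQ _).comp (Submodule.inclusion hV)
  have hf : Function.Surjective f := by
    intro q
    obtain ⟨⟨x, hx⟩, rfl⟩ := Submodule.mkQ_surjective _ q
    obtain ⟨v, hv, y, hy, hvy⟩ := Submodule.mem_sup.1 (hspan hx)
    obtain ⟨h, hh, p, hp, rfl⟩ := Submodule.mem_sup.1 hy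
    refine ⟨⟨v, hv⟩, ?_⟩
    refine ((Submodule.Quotient.eq _).2 ?_).symm
    rw [Submodule.mem_comap]
    change x - v ∈ _
    have hxv : x - v = h + p := by rw [← hvy, add_sub_cancel_left]
    rw [hxv]
    have hh' : h ∈ PLe n w := by
      have : h = x - v - p := by rw [hxv, add_sub_cancel_right]
      rw [this]
      exact sub_mem (sub_mem hx (hV hv)) (PMinus_le_PLe n w hp)
    exact add_mem (Submodule.mem_sup_left ⟨hh, hh'⟩) (Submodule.mem_sup_right hp)
  exact ⟨Module.Finite.of_surjective f hf,
    (LinearMap.finrank_le_finrank_of_surjective hf).trans (finrank_span_finset_le_card B)⟩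

theorem monomial_mem_sup {w : List ℕ} {H : Finset ℕ} (hH : LeadSet (IsRel w) 65536 H)
    {V : Submodule (ZMod 2) P5} (hV : ∀ c < 65536, c ∉ H → decode c ∈ fam w →
      monomial (expo (decode c)) 1 ∈ V) {c : ℕ} (hc : c < 65536) (hcw : decode c ∈ fam w) :
    monomial (expo (decode c)) 1 ∈ V ⊔ (hitSpan 23 ⊔ PMinus 23 w) := by
  induction c using Nat.strong_induction_on with
  | _ c ih =>
    by_cases hcH : c ∈ H
    · obtain ⟨-, N, ⟨-, hN, hNw⟩, hbit, hbits⟩ := hH c hcH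
      have hsum : rowPoly N - monomial (expo (decode c)) 1 ∈
          V ⊔ (hitSpan 23 ⊔ PMinus 23 w) := by
        rw [rowPoly, ← Finset.sum_erase_add _ _ (Finset.mem_range.2 (show c < 2 ^ 17 by omega)),
          Nat.mod_eq_of_lt hc, show bit N c = 1 by simp [bit, hbit], add_sub_cancel_right]
        refine sum_mem fun i hi => ?_
        rcases lt_or_gt_of_ne (Finset.ne_of_mem_erase hi) with hlt | hlt
        · rw [Nat.mod_eq_of_lt (hlt.trans hc)]
          cases hb : N.testBit i with
          | false => simp [bit, hb]
          | true =>
            rw [show bit N i = 1 by simp [bit, hb]]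
            exact ih i hlt (hlt.trans hc) (mem_fam.2 ⟨rfl, (hNw i (hlt.trans hc) hb).2⟩)
        · simp [bit, hbits i hlt]
      simpa using sub_mem (Submodule.mem_sup_right (S := V) hN) hsum
    · exact Submodule.mem_sup_left (hV c hc hcH hcw)

theorem finrank_QPw_add_rankBelow_le {w : List ℕ} (hw : w.length ≤ 4)
    (h23 : Nat.ofDigits 2 w = 23) {rows : List ℕ} (hrows : ∀ r ∈ rows, IsRel w r) :
    Module.Finite (ZMod 2) (QPw 23 w) ∧
    Module.finrank (ZMod 2) (QPw 23 w) + rankBelow 17 65536 rows ≤ (fam w).length := by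
  obtain ⟨H, hH, hcard⟩ := exists_leadSet_card_eq (P := IsRel w) (d := 17) (b := 65536)
    (fun N hN => hN.1) (fun _ _ => isRel_xor) hrows
  have hdec : ∀ s ∈ fam w, decode (code s % 65536) = s := fun s hs =>
    decode_code (length_of_mem_fam hs) (fun a ha => (lt_of_mem_fam hs a ha).trans_le
      (Nat.pow_le_pow_right (n := 2) (by norm_num) hw)) ((sum_of_mem_fam hs).trans h23)
  let B := (fam w).toFinset.filter fun s => code s % 65536 ∉ H
  have hHA : H.image decode ⊆ (fam w).toFinset.filter fun s => ¬ code s % 65536 ∉ H := by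
    intro s hs
    obtain ⟨c, hc, rfl⟩ := Finset.mem_image.1 hs
    obtain ⟨hc', N, hN, hlead⟩ := hH c hc
    simp only [Finset.mem_filter, List.mem_toFinset, not_not, code_decode hc', hc, and_true]
    exact mem_fam.2 ⟨rfl, (hN.2.2 c hc' hlead.1).2⟩
  have hinj : Set.InjOn decode H := by
    intro c hc c' hc' h
    rw [← code_decode (hH c hc).1, h, code_decode (hH c' hc').1]
  have hBcard : B.card + H.card ≤ (fam w).length := by
    rw [← Finset.card_image_of_injOn hinj]
    refine (Nat.add_le_add_left (Finset.card_le_card hHA) _).trans ?_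
    rw [Finset.card_filter_add_card_filter_not]
    exact List.toFinset_card_le _
  have hfin := finrank_QPw_le (n := 23) (w := w)
    (B := B.image fun s => (monomial (expo s) 1 : P5)) (fun b hb => by
      obtain ⟨s, hs, rfl⟩ := Finset.mem_image.1 hb
      have := monomial_mem_PLe (List.mem_toFinset.1 (Finset.mem_filter.1 hs).1)
      rwa [h23] at this) (Submodule.span_le.2 ?_)
  · refine ⟨hfin.1, ?_⟩
    have := hfin.2.trans Finset.card_image_le
    omega
  · rintro _ ⟨d, rfl, hd, hlt | heq⟩
    · exact Submodule.mem_sup_right (Submodule.mem_sup_right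
        (Submodule.subset_span ⟨d, rfl, hd, hlt⟩))
    · rw [← expo_ofFn d] at heq ⊢
      have hs : List.ofFn d ∈ fam w := mem_fam.2 ⟨by simp, heq⟩
      rw [← hdec _ hs]
      refine monomial_mem_sup hH (fun c hc hcH hcw => Submodule.subset_span ?_)
        (Nat.mod_lt _ (by norm_num)) (by rwa [hdec _ hs])
      refine Finset.mem_coe.2 (Finset.mem_image_of_mem _ ?_)
      simp only [B, Finset.mem_filter, List.mem_toFinset, code_decode hc]
      exact ⟨hcw, hcH⟩

/-! ### Lower bounds -/

/-- The linear form whose coefficients are the binary digits of `a`. -/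
def lin (a : ℕ) : P5 := ∑ i : Fin 5, (if a.testBit i then X i else 0)

/-- The substitution of linear forms for the variables. -/
def subst (cols : List ℕ) : P5 →ₐ[ZMod 2] P5 := aeval fun j => lin (cols.getD j 0)

theorem isHomogeneous_lin (a : ℕ) : (lin a).IsHomogeneous 1 := by
  refine IsHomogeneous.sum _ _ _ fun i _ => ?_
  split_ifs
  · exact isHomogeneous_X _ _
  · exact isHomogeneous_zero _ _ _

theorem isHomogeneous_subst (cols : List ℕ) {p : P5} {n : ℕ} (hp : p.IsHomogeneous n) :
    (subst cols p).IsHomogeneous n := by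
  have := hp.aeval (fun j : Fin 5 => lin (cols.getD j 0)) fun j => isHomogeneous_lin _
  rwa [one_mul] at this

theorem homogeneousComponent_subst (cols : List ℕ) (n : ℕ) (p : P5) :
    homogeneousComponent n (subst cols p) = subst cols (homogeneousComponent n p) := by
  induction p using MvPolynomial.induction_on' with
  | monomial d c =>
    have h := isHomogeneous_monomial (σ := Fin 5) (d := d) c rfl
    rw [homogeneousComponent_of_mem h, homogeneousComponent_of_mem (isHomogeneous_subst cols h)]
    split_ifs <;> simp
  | add p q hp hq => simp only [map_add, hp, hq]

theorem Sq_lin (a : ℕ) : Sq (lin a) = lin a + lin a ^ 2 := by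
  rw [lin, CharTwo.sum_sq, map_sum, ← Finset.sum_add_distrib]
  refine Finset.sum_congr rfl fun i _ => ?_
  split_ifs
  · simp [Sq]
  · simp

theorem Sq_subst (cols : List ℕ) (p : P5) : Sq (subst cols p) = subst cols (Sq p) := by
  have : Sq.comp (subst cols) = (subst cols).comp Sq := by
    ext1 j
    simp [subst, Sq_lin]
    simp [Sq]
  exact DFunLike.congr_fun this p

theorem subst_mem_hitSpan (cols : List ℕ) {n : ℕ} {p : P5} (hp : p ∈ hitSpan n) :
    subst cols p ∈ hitSpan n := by
  have : hitSpan n ≤ (hitSpan n).comap (subst cols).toLinearMap := by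
    refine Submodule.span_le.2 ?_
    rintro _ ⟨g, hg, rfl⟩
    refine Submodule.subset_span ⟨subst cols g, fun m hm => ?_, ?_⟩
    · rw [homogeneousComponent_subst, hg m hm, map_zero]
    · rw [Sq_subst, homogeneousComponent_subst]
      rfl
  exact this hp

theorem coeff_mul_sq {A Q : P5} {a : ℕ} {o h : Fin 5 →₀ ℕ} (hA : A.IsHomogeneous a)
    (ho : ∀ j, o j < 2) (ha : a ≤ o.degree) :
    coeff (o + 2 • h) (A * Q ^ 2) = coeff o A * coeff h Q := by
  rw [← expand_zmod, coeff_mul, Finset.sum_eq_single (o, 2 • h)]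
  · rw [coeff_expand_smul _ two_ne_zero]
  · rintro ⟨e, f⟩ hef hne
    rw [Finset.HasAntidiagonal.mem_antidiagonal] at hef
    by_cases hdvd : ∀ j, 2 ∣ f j
    · rw [hA.coeff_eq_zero, zero_mul]
      rintro rfl
      have hle : o ≤ e := by
        intro j
        have := DFunLike.congr_fun hef j
        simp at this
        have := ho j
        have := hdvd j
        omega
      have : o = e := by
        obtain ⟨c, rfl⟩ := exists_add_of_le hle
        rw [map_add] at ha
        have : c.degree = 0 := by omega
        rw [Finsupp.degree_eq_zero_iff] at this
        rw [this, add_zero]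
      subst this
      exact hne (congrArg _ (add_left_cancel hef))
    · push Not at hdvd
      obtain ⟨j, hj⟩ := hdvd
      rw [coeff_expand_of_not_dvd _ hj, mul_zero]
  · simp

theorem expo_double {s b : List ℕ} (hs : s.length = 5) (hb : b.length = 5) :
    expo (double s b) = expo b + 2 • expo s := by
  obtain ⟨s0, s1, s2, s3, s4, rfl⟩ := exists_eq_of_length hs
  obtain ⟨b0, b1, b2, b3, b4, rfl⟩ := exists_eq_of_length hb
  ext j
  simp only [double, List.zipWith_cons_cons, List.zipWith_nil_left]
  fin_cases j <;> simp <;> exact Nat.add_comm _ _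

theorem monomial_double {s b : List ℕ} (hs : s.length = 5) (hb : b.length = 5) :
    (monomial (expo (double s b)) 1 : P5) = monomial (expo b) 1 * monomial (expo s) 1 ^ 2 := by
  rw [expo_double hs hb, monomial_pow, monomial_mul, one_pow, one_mul]

theorem isHomogeneous_monomial_expo {s : List ℕ} (hs : s.length = 5) :
    (monomial (expo s) 1 : P5).IsHomogeneous s.sum :=
  isHomogeneous_monomial _ (by rw [Finsupp.degree_eq_sum, sum_expo hs])

/-- The coefficient of `x ^ s` in the image of `x ^ m` under a substitution. -/
def pairing (cols m s : List ℕ) : ZMod 2 :=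
  coeff (expo s) (subst cols (monomial (expo m) 1))

theorem lt_two_of_mem_map_mod {s : List ℕ} : ∀ a ∈ s.map (· % 2), a < 2 := by
  intro a ha
  obtain ⟨c, -, rfl⟩ := List.mem_map.1 ha
  exact Nat.mod_lt c two_pos

theorem pairing_double {cols m b s o : List ℕ} (hm : m.length = 5) (hb : b.length = 5)
    (hs : s.length = 5) (ho : o.length = 5) (ho2 : ∀ a ∈ o, a < 2) (hbo : b.sum ≤ o.sum) :
    pairing cols (double m b) (double s o) = pairing cols b o * pairing cols m s := by
  rw [pairing, monomial_double hm hb, map_mul, map_pow, expo_double hs ho,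
    coeff_mul_sq (isHomogeneous_subst cols (isHomogeneous_monomial_expo hb))]
  · rfl
  · intro j
    rw [expo_apply, List.getD_eq_getElem _ _ (by omega)]
    exact ho2 _ (List.getElem_mem _)
  · rwa [Finsupp.degree_eq_sum, sum_expo ho]

theorem pairing_eq_zero {cols m s : List ℕ} (hm : m.length = 5) (hs : s.length = 5)
    (h : LexLt (wt (expo m)) (wt (expo s))) : pairing cols m s = 0 := by
  obtain ⟨i, heq, hlt⟩ := h
  induction i generalizing m s with
  | zero =>
    rw [wt_expo_zero hm, wt_expo_zero hs] at hlt
    rw [← double_map m, ← double_map s, pairing_double (by simpa using hm) (by simpa using hm)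
      (by simpa using hs) (by simpa using hs) lt_two_of_mem_map_mod hlt.le, pairing,
      (isHomogeneous_subst cols (isHomogeneous_monomial_expo (by simpa using hm))).coeff_eq_zero,
      zero_mul]
    rw [Finsupp.degree_eq_sum, sum_expo (by simpa using hs)]
    exact hlt.ne'
  | succ i ih =>
    have h0 := heq 0 i.succ_pos
    rw [wt_expo_zero hm, wt_expo_zero hs] at h0
    rw [← double_map m, ← double_map s, pairing_double (by simpa using hm) (by simpa using hm)
      (by simpa using hs) (by simpa using hs) lt_two_of_mem_map_mod h0.le,
      ih (m := m.map (· / 2)) (s := s.map (· / 2)) (by simpa using hm) (by simpa using hs),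
      mul_zero]
    · intro j hj
      rw [← wt_expo_succ hm, ← wt_expo_succ hs]
      exact heq (j + 1) (by omega)
    · rwa [← wt_expo_succ hm, ← wt_expo_succ hs]

/-- Whether `x ^ s` occurs in `Sq (x ^ m)`. -/
def occurs (m s : List ℕ) : Bool :=
  (List.zipWith (fun a c => decide (a ≤ c) && (c - a) &&& a == c - a) m s).all id

/-- All `m` such that `x ^ s` occurs in `Sq (x ^ m)`. -/
def sources : List ℕ → List (List ℕ)
  | [] => [[]]
  | c :: s => ((List.range (c + 1)).filter fun a => (c - a) &&& a == c - a).flatMap fun a =>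
      (sources s).map (List.cons a)

theorem natCast_countP {α : Type} (q : α → Bool) (L : List α) :
    (L.countP q : ZMod 2) = (L.map fun s => if q s then 1 else 0).sum := by
  induction L with
  | nil => rfl
  | cons a L ih =>
    rw [List.countP_cons, Nat.cast_add, ih, List.map_cons, List.sum_cons, add_comm]
    simp

/-- Whether the sum of the coefficients of the monomials in `S` vanishes on hit polynomials. -/
def killsHits (n : ℕ) (S : List (List ℕ)) : Bool :=
  S.all fun s => s.length == 5 && s.sum == n && (sources s).all fun m =>
    m.sum == n || S.countP (occurs m) % 2 == 0

theorem listCoeff_eq (m s : List ℕ) : listCoeff m s = if occurs m s then 1 else 0 := by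
  induction m generalizing s with
  | nil => rfl
  | cons a m ih =>
    rcases s with _ | ⟨c, s⟩
    · rfl
    · simp only [listCoeff, occurs, List.zipWith_cons_cons, List.prod_cons, List.all_cons] at ih ⊢
      rw [ih, choose_cast_eq]
      by_cases h1 : a ≤ c <;> by_cases h2 : (c - a) &&& a = c - a <;> simp [h1, h2]

theorem mem_sources {m s : List ℕ} (hl : m.length = s.length) (h : occurs m s = true) :
    m ∈ sources s := by
  induction m generalizing s with
  | nil =>
    rw [List.eq_nil_of_length_eq_zero hl.symm]
    simp [sources]
  | cons a m ih =>
    rcases s with _ | ⟨c, s⟩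
    · simp at hl
    · simp only [occurs, List.zipWith_cons_cons, List.all_cons, Bool.and_eq_true] at h ih
      simp only [id, Bool.and_eq_true, decide_eq_true_eq] at h
      simp only [sources, List.mem_flatMap, List.mem_filter, List.mem_range, List.mem_map]
      exact ⟨a, ⟨by omega, h.1.2⟩, m, ih (by simpa using hl) h.2, rfl⟩

/-- The sum of the coefficients of the monomials in `S`. -/
def coeffSum (S : List (List ℕ)) : P5 →ₗ[ZMod 2] ZMod 2 :=
  (S.map fun s => lcoeff (ZMod 2) (expo s)).sum

theorem coeffSum_apply (S : List (List ℕ)) (p : P5) :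
    coeffSum S p = (S.map fun s => coeff (expo s) p).sum := by
  induction S with
  | nil => rfl
  | cons s S ih =>
    simp only [coeffSum, List.map_cons, List.sum_cons, LinearMap.add_apply] at ih ⊢
    rw [ih]
    rfl

theorem coeffSum_eq_zero {n : ℕ} {S : List (List ℕ)} (hS : killsHits n S = true) {p : P5}
    (hp : p ∈ hitSpan n) : coeffSum S p = 0 := by
  simp only [killsHits, List.all_eq_true, Bool.and_eq_true, beq_iff_eq, Bool.or_eq_true] at hS
  have hmon : ∀ m : List ℕ, m.length = 5 → m.sum < n →
      coeffSum S (homogeneousComponent n (Sq (monomial (expo m) 1))) = 0 := by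
    intro m hm hmn
    have hcount : coeffSum S (homogeneousComponent n (Sq (monomial (expo m) 1))) =
        (S.countP (occurs m) : ZMod 2) := by
      rw [coeffSum_apply, natCast_countP]
      congr 1
      refine List.map_congr_left fun s hs => ?_
      obtain ⟨⟨hs1, hs2⟩, -⟩ := hS s hs
      rw [coeff_homogeneousComponent, coeff_Sq, sqCoeff_expo hm hs1, listCoeff_eq,
        Finsupp.degree_eq_sum, sum_expo hs1, if_pos hs2]
    rw [hcount]
    by_cases h0 : S.countP (occurs m) = 0
    · rw [h0, Nat.cast_zero]
    · obtain ⟨s, hs, hms⟩ := List.countP_pos_iff.1 (Nat.pos_of_ne_zero h0)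
      obtain ⟨⟨hs1, hs2⟩, hs3⟩ := hS s hs
      have h2 := (hs3 m (mem_sources (hm.trans hs1.symm) hms)).resolve_left hmn.ne
      rw [ZMod.natCast_eq_zero_iff]
      omega
  have : hitSpan n ≤ LinearMap.ker (coeffSum S) := by
    refine Submodule.span_le.2 ?_
    rintro _ ⟨g, hg, rfl⟩
    rw [SetLike.mem_coe, LinearMap.mem_ker, ← support_sum_monomial_coeff g, map_sum, map_sum,
      map_sum]
    refine Finset.sum_eq_zero fun d hd => ?_
    have hdn : ∑ j, d j < n := by
      by_contra hle
      have := congrArg (coeff d) (hg d.degree (by rw [Finsupp.degree_eq_sum]; omega))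
      rw [coeff_homogeneousComponent, if_pos rfl] at this
      exact mem_support_iff.1 hd this
    have h1 : (monomial d (coeff d g) : P5) = coeff d g • monomial d 1 := by
      rw [smul_monomial, smul_eq_mul, mul_one]
    rw [h1, map_smul, map_smul, map_smul, ← expo_ofFn d, hmon _ (by simp), smul_zero]
    rwa [List.sum_ofFn]
  exact this hp

/-- The first five binary digits of `c`. -/
def bitsOf (c : ℕ) : List ℕ :=
  [Nat.mod c 2, Nat.mod (Nat.div c 2) 2, Nat.mod (Nat.div c 4) 2, Nat.mod (Nat.div c 8) 2,
    Nat.mod (Nat.div c 16) 2]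

/-- The exponents whose binary digits are given by `bitsOf`. -/
def seedOf (cs : List ℕ) : List ℕ := fold (fun c s => double s (bitsOf c)) [0, 0, 0, 0, 0] cs

/-- Polynomials modulo `x_i ^ 2` are stored by the coefficients of the `x ^ bitsOf c`, `c < 32`;
this is multiplication by `lin a`. -/
def mulCol (a u : ℕ) : ℕ :=
  Nat.xor (Nat.mul (Nat.land u (Nat.mul 1431655765 (Nat.mod a 2))) 2)
  (Nat.xor (Nat.mul (Nat.land u (Nat.mul 858993459 (Nat.mod (Nat.div a 2) 2))) 4)
  (Nat.xor (Nat.mul (Nat.land u (Nat.mul 252645135 (Nat.mod (Nat.div a 4) 2))) 16)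
  (Nat.xor (Nat.mul (Nat.land u (Nat.mul 16711935 (Nat.mod (Nat.div a 8) 2))) 256)
  (Nat.mul (Nat.land u (Nat.mul 65535 (Nat.mod (Nat.div a 16) 2))) 65536))))

/-- The products of `w` of the linear forms `cols`. -/
def minors (cols : List ℕ) : ℕ → List ℕ :=
  List.rec (fun w => cond (Nat.beq w 0) [1] []) (fun a _ ih w => fold List.cons
    (Nat.rec [] (fun v _ => fold (fun u l => mulCol a u :: l) [] (ih v)) w) (ih w)) cols

/-- Concatenate copies of the binary number `N` of length `size`, multiplied by the `c`-th digits
of the entries of `us`. -/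
def horner (N size c : ℕ) (us : List ℕ) : ℕ :=
  fold (fun u r => Nat.xor (Nat.shiftLeft r size) (Nat.mul N (Nat.mod (Nat.shiftRight u c) 2))) 0 us

/-- The coefficients of `x ^ seedOf cs` in the images of the monomials of a given weight. -/
def tensor (cols : List ℕ) (L : List (ℕ × ℕ)) : List ℕ → ℕ :=
  List.rec (fun _ => 1) (fun w _ ih cs =>
    List.rec 0 (fun c cs _ => horner (ih cs) w.2 c (minors cols w.1)) cs) L

/-- The first `n` digits of `x` in base `32`. -/
def digits (n : ℕ) : ℕ → List ℕ :=
  Nat.rec (fun _ => []) (fun _ ih x => Nat.mod x 32 :: ih (Nat.div x 32)) n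

/-- The sum of the rows `tensor` for the given seeds. -/
def leadRow (cols : List ℕ) (L : List (ℕ × ℕ)) (seeds : List (List ℕ)) : ℕ :=
  fold (fun cs r => Nat.xor (tensor cols L cs) r) 0 seeds

/-- The rows `leadRow` for the given substitutions. -/
def leadRows (L : List (ℕ × ℕ)) (seeds : List (List ℕ)) (gs : List ℕ) : List ℕ :=
  fold (fun g l => leadRow (digits 5 g) L seeds :: l) [] gs

theorem length_digits (n x : ℕ) : (digits n x).length = n := by
  induction n generalizing x with
  | zero => rfl
  | succ n ih => exact congrArg (· + 1) (ih (x / 32))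

theorem lt_two_of_mem_bitsOf {c : ℕ} : ∀ a ∈ bitsOf c, a < 2 := by
  intro a ha
  simp only [bitsOf, List.mem_cons, List.not_mem_nil, or_false] at ha
  rcases ha with rfl | rfl | rfl | rfl | rfl <;> exact Nat.mod_lt _ two_pos

theorem bit_mask {M e i : ℕ} (hM : ∀ c < 32, (decide (e ≤ c) && M.testBit (c - e)) = c.testBit i)
    (a u : ℕ) {c : ℕ} (hc : c < 32) :
    bit ((u &&& (M * (a / 2 ^ i % 2))) * 2 ^ e) c =
      if a.testBit i then if c.testBit i then bit u (c - e) else 0 else 0 := by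
  rw [bit, Nat.testBit_mul_two_pow, Nat.testBit_land, ← hM c hc,
    Nat.testBit_eq_decide_div_mod_eq (x := a)]
  rcases Nat.mod_two_eq_zero_or_one (a / 2 ^ i) with h | h
  · simp [h]
  · rw [h, mul_one, bit]
    by_cases h1 : e ≤ c <;> cases M.testBit (c - e) <;> simp [h1]

theorem bit_mulCol (a u : ℕ) {c : ℕ} (hc : c < 32) : bit (mulCol a u) c =
    ∑ i : Fin 5, if a.testBit i then if c.testBit i then bit u (c - 2 ^ (i : ℕ)) else 0 else 0 := by
  have : mulCol a u = (u &&& (1431655765 * (a / 2 ^ 0 % 2))) * 2 ^ 1 ^^^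
      ((u &&& (858993459 * (a / 2 ^ 1 % 2))) * 2 ^ 2 ^^^
      ((u &&& (252645135 * (a / 2 ^ 2 % 2))) * 2 ^ 4 ^^^
      ((u &&& (16711935 * (a / 2 ^ 3 % 2))) * 2 ^ 8 ^^^
      (u &&& (65535 * (a / 2 ^ 4 % 2))) * 2 ^ 16))) := by
    rw [pow_zero, Nat.div_one]
    rfl
  rw [this, bit_xor, bit_xor, bit_xor, bit_xor, bit_mask (by decide) a u hc,
    bit_mask (by decide) a u hc, bit_mask (by decide) a u hc, bit_mask (by decide) a u hc,
    bit_mask (by decide) a u hc, Fin.sum_univ_five]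
  simp only [add_assoc]
  rfl

theorem expo_bitsOf_apply (c : ℕ) (i : Fin 5) : expo (bitsOf c) i = (c.testBit i).toNat := by
  rw [expo_apply, Nat.toNat_testBit]
  fin_cases i <;> first | rfl | exact congrArg (· % 2) (Nat.div_one c).symm

theorem expo_bitsOf_sub {c : ℕ} (hc : c < 32) (i : Fin 5) (hi : c.testBit i = true) :
    expo (bitsOf c) - Finsupp.single i 1 = expo (bitsOf (c - 2 ^ (i : ℕ))) := by
  have key : ∀ c < 32, ∀ i j : Fin 5, c.testBit i = true →
      (c.testBit j).toNat - (if i = j then 1 else 0) = ((c - 2 ^ (i : ℕ)).testBit j).toNat := by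
    decide
  ext j
  rw [Finsupp.tsub_apply, expo_bitsOf_apply, expo_bitsOf_apply, Finsupp.single_apply]
  exact key c hc i j hi

theorem coeff_lin_mul (a : ℕ) (p : P5) {c : ℕ} (hc : c < 32) :
    coeff (expo (bitsOf c)) (lin a * p) = ∑ i : Fin 5, if a.testBit i then
      if c.testBit i then coeff (expo (bitsOf (c - 2 ^ (i : ℕ)))) p else 0 else 0 := by
  rw [lin, Finset.sum_mul, coeff_sum]
  refine Finset.sum_congr rfl fun i _ => ?_
  by_cases ha : a.testBit i
  · rw [if_pos ha, if_pos ha, coeff_X_mul']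
    by_cases hi : c.testBit i
    · rw [if_pos hi, if_pos, expo_bitsOf_sub hc i hi]
      rw [Finsupp.mem_support_iff, expo_bitsOf_apply, hi]
      exact one_ne_zero
    · rw [if_neg hi, if_neg]
      rw [Finsupp.mem_support_iff, expo_bitsOf_apply, Bool.eq_false_iff.2 hi, not_not]
      rfl
  · simp [ha]

/-- The product of the linear forms `cols` with exponents `b`, stored as in `mulCol`. -/
def colProd : List ℕ → List ℕ → ℕ
  | a :: cols, b :: bs => if b = 0 then colProd cols bs else mulCol a (colProd cols bs)
  | _, _ => 1

theorem fold_map {α β : Type} (f : α → β) (l : List α) :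
    fold (fun a r => f a :: r) [] l = l.map f := by
  induction l with
  | nil => rfl
  | cons a l ih => exact congrArg (List.cons (f a)) ih

theorem minors_eq (cols : List ℕ) (w : ℕ) :
    minors cols w = (bitLists cols.length w).map (colProd cols) := by
  induction cols generalizing w with
  | nil => cases w <;> rfl
  | cons a cols ih =>
    have h0 : ∀ w, (bitLists cols.length w).map (colProd cols) =
        ((bitLists cols.length w).map (List.cons 0)).map (colProd (a :: cols)) := by
      intro w
      rw [List.map_map]
      rfl
    change fold List.cons (Nat.rec [] (fun v _ => fold (fun u l => mulCol a u :: l) []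
      (minors cols v)) w) (minors cols w) = _
    rw [fold_eq, List.foldr_cons_eq_append', ih]
    cases w with
    | zero =>
      rw [h0]
      change _ ++ [] = _
      rw [List.append_nil]
      rfl
    | succ w =>
      have h1 : fold (fun u l => mulCol a u :: l) [] (minors cols w) =
          ((bitLists cols.length w).map (List.cons 1)).map (colProd (a :: cols)) := by
        rw [fold_map, ih, List.map_map, List.map_map]
        rfl
      rw [h0]
      change _ ++ fold _ _ _ = _
      rw [h1, ← List.map_append]
      rfl

theorem bit_one {c : ℕ} (hc : c < 32) : bit 1 c = coeff (expo (bitsOf c)) 1 := by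
  rw [coeff_one, bit]
  have key : ∀ c < 32, (Nat.testBit 1 c = true ↔ ∀ i : Fin 5, c.testBit i = false) := by decide
  have h2 : 0 = expo (bitsOf c) ↔ Nat.testBit 1 c = true := by
    rw [key c hc, eq_comm, DFunLike.ext_iff]
    refine forall_congr' fun i => ?_
    rw [expo_bitsOf_apply]
    cases c.testBit i <;> simp
  by_cases h : Nat.testBit 1 c = true
  · rw [if_pos (h2.2 h), h]
    rfl
  · rw [if_neg (mt h2.1 h), Bool.eq_false_iff.2 h]
    rfl

theorem bit_colProd {cols b : List ℕ} (hb : ∀ a ∈ b, a < 2) {c : ℕ} (hc : c < 32) :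
    bit (colProd cols b) c =
      coeff (expo (bitsOf c)) (List.zipWith (fun a k => lin a ^ k) cols b).prod := by
  induction cols generalizing b c with
  | nil => simpa [colProd] using bit_one hc
  | cons a cols ih =>
    rcases b with _ | ⟨k, b⟩
    · simpa [colProd] using bit_one hc
    · have hb' : ∀ a ∈ b, a < 2 := fun a ha => hb a (List.mem_cons_of_mem _ ha)
      rw [colProd, List.zipWith_cons_cons, List.prod_cons]
      have hk := hb k List.mem_cons_self
      interval_cases k
      · rw [if_pos rfl, pow_zero, one_mul, ih hb' hc]
      · rw [if_neg one_ne_zero, pow_one, coeff_lin_mul _ _ hc, bit_mulCol _ _ hc]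
        refine Finset.sum_congr rfl fun i _ => ?_
        rw [ih hb' ((Nat.sub_le _ _).trans_lt hc)]

theorem subst_monomial {cols b : List ℕ} (hcols : cols.length = 5) (hb : b.length = 5) :
    subst cols (monomial (expo b) 1) = (List.zipWith (fun a k => lin a ^ k) cols b).prod := by
  obtain ⟨b0, b1, b2, b3, b4, rfl⟩ := exists_eq_of_length hb
  obtain ⟨c0, c1, c2, c3, c4, rfl⟩ := exists_eq_of_length hcols
  rw [subst, aeval_monomial, map_one, one_mul, Finsupp.prod_fintype _ _ (fun _ => pow_zero _),
    Fin.prod_univ_five]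
  simp [expo_apply, mul_assoc]

/-- The binary digits of `N` are `vals`. -/
def HasDigits (N : ℕ) (vals : List (ZMod 2)) : Prop := ∀ i, bit N i = vals.getD i 0

theorem hasDigits_xor {α : Type} {l : List α} {f g : α → ZMod 2} {M N : ℕ}
    (hM : HasDigits M (l.map f)) (hN : HasDigits N (l.map g)) : HasDigits (M ^^^ N) (l.map fun m => f m + g m) := by
  intro i
  rw [bit_xor, hM, hN]
  by_cases hi : i < l.length <;> simp [hi]

theorem hasDigits_horner {N c : ℕ} {vals : List (ZMod 2)} (hN : HasDigits N vals) (us : List ℕ) :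
    HasDigits (horner N vals.length c us) (us.flatMap fun u => vals.map (bit u c * ·)) := by
  induction us with
  | nil => exact fun i => by simp [horner, fold, bit_zero]
  | cons u us ih =>
    intro i
    change bit ((horner N vals.length c us <<< vals.length) ^^^ (N * ((u >>> c) % 2))) i = _
    have h : bit (N * ((u >>> c) % 2)) i = bit u c * bit N i := by
      have hu : bit u c = (u >>> c % 2 : ℕ) := by
        rw [bit, Nat.toNat_testBit, Nat.shiftRight_eq_div_pow]
      rw [hu]
      rcases Nat.mod_two_eq_zero_or_one (u >>> c) with h | h
      · rw [h, mul_zero, bit_zero, Nat.cast_zero, zero_mul]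
      · rw [h, mul_one, Nat.cast_one, one_mul]
    rw [bit_xor, h, hN, List.flatMap_cons]
    by_cases hi : i < vals.length
    · rw [List.getD_append _ _ _ _ (by simpa using hi)]
      simp [bit, hi, hi.not_ge]
    · rw [List.getD_append_right _ _ _ _ (by simpa using hi), List.length_map, ← ih]
      simp [bit, hi, not_lt.1 hi]

/-- Whether `seedOf cs` has the weight given by the first components of `L`, with the second
components counting the monomials whose weight is given by the remaining list. -/
def fits : List (ℕ × ℕ) → List ℕ → Bool
  | [], [] => true
  | (w, n) :: L, c :: cs =>
    Nat.blt c 32 && Nat.beq (bitsOf c).sum w && Nat.beq n (fam (L.map Prod.fst)).length && fits L cs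
  | _, _ => false

theorem seedOf_mem_fam {L : List (ℕ × ℕ)} {cs : List ℕ} (h : fits L cs = true) :
    seedOf cs ∈ fam (L.map Prod.fst) := by
  induction L generalizing cs with
  | nil =>
    rcases cs with _ | ⟨c, cs⟩
    · exact List.mem_singleton_self _
    · simp [fits] at h
  | cons x L ih =>
    rcases cs with _ | ⟨c, cs⟩
    · simp [fits] at h
    · simp only [fits, Bool.and_eq_true, Nat.beq_eq] at h
      rw [List.map_cons, fam, List.mem_flatMap]
      exact ⟨bitsOf c, mem_bitLists.2 ⟨rfl, lt_two_of_mem_bitsOf, h.1.1.2⟩,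
        List.mem_map.2 ⟨_, ih h.2, rfl⟩⟩

theorem hasDigits_tensor {cols : List ℕ} (hcols : cols.length = 5) {L : List (ℕ × ℕ)} {cs : List ℕ}
    (h : fits L cs = true) : HasDigits (tensor cols L cs)
      ((fam (L.map Prod.fst)).map fun m => pairing cols m (seedOf cs)) := by
  induction L generalizing cs with
  | nil =>
    rcases cs with _ | ⟨c, cs⟩
    · have h0 : expo [0, 0, 0, 0, 0] = 0 := by
        ext j
        fin_cases j <;> rfl
      have h1 : pairing cols [0, 0, 0, 0, 0] [0, 0, 0, 0, 0] = 1 := by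
        rw [pairing, h0, monomial_zero', map_one, map_one]
        exact coeff_zero_one
      intro i
      change bit 1 i = [pairing cols [0, 0, 0, 0, 0] [0, 0, 0, 0, 0]].getD i 0
      rw [h1]
      rcases i with _ | i
      · rfl
      · simp [bit, Nat.testBit_succ]
    · simp [fits] at h
  | cons x L ih =>
    rcases cs with _ | ⟨c, cs⟩
    · simp [fits] at h
    · simp only [fits, Bool.and_eq_true, Nat.beq_eq] at h
      obtain ⟨⟨⟨hc, hw⟩, hn⟩, hL⟩ := h
      have hc : c < 32 := by simpa [Nat.blt] using hc
      have hN := hasDigits_horner (c := c) (ih hL) (minors cols x.1)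
      rw [List.length_map, ← hn] at hN
      change HasDigits (horner (tensor cols L cs) x.2 c (minors cols x.1)) _
      refine Eq.mp (congrArg (HasDigits _) ?_) hN
      symm
      rw [List.map_cons, fam, minors_eq, hcols, List.flatMap_map, List.map_flatMap]
      refine List.flatMap_congr fun b hb => ?_
      obtain ⟨hb5, hb2, hbw⟩ := mem_bitLists.1 hb
      rw [List.map_map, List.map_map]
      refine List.map_congr_left fun m hm => ?_
      change pairing cols (double m b) (double (seedOf cs) (bitsOf c)) = _ * _
      rw [pairing_double (length_of_mem_fam hm) hb5 (length_of_mem_fam (seedOf_mem_fam hL)) rfl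
        lt_two_of_mem_bitsOf (by rw [hbw, hw]), bit_colProd hb2 hc, ← subst_monomial hcols hb5]
      rfl

theorem hasDigits_leadRow {cols : List ℕ} (hcols : cols.length = 5) {L : List (ℕ × ℕ)}
    {seeds : List (List ℕ)} (h : ∀ cs ∈ seeds, fits L cs = true) : HasDigits (leadRow cols L seeds)
      ((fam (L.map Prod.fst)).map fun m =>
        (seeds.map fun cs => pairing cols m (seedOf cs)).sum) := by
  induction seeds with
  | nil =>
    intro i
    change bit 0 i = _
    by_cases hi : i < (fam (L.map Prod.fst)).length <;> simp [bit_zero, hi]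
  | cons cs seeds ih =>
    have := hasDigits_xor (hasDigits_tensor hcols (h cs List.mem_cons_self))
      (ih fun cs' hcs' => h cs' (List.mem_cons_of_mem _ hcs'))
    simp only [List.map_cons, List.sum_cons]
    exact this

/-- `N` stores the values on the monomials of weight `w` of a linear functional which vanishes on
hit polynomials and on monomials of smaller weight. -/
def IsFunctional (w : List ℕ) (N : ℕ) : Prop :=
  ∃ ψ : P5 →ₗ[ZMod 2] ZMod 2, (∀ p ∈ hitSpan 23, ψ p = 0) ∧ (∀ p ∈ PMinus 23 w, ψ p = 0) ∧
    HasDigits N ((fam w).map fun m => ψ (monomial (expo m) 1))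

theorem isFunctional_xor {w : List ℕ} {M N : ℕ} (hM : IsFunctional w M) (hN : IsFunctional w N) :
    IsFunctional w (M ^^^ N) := by
  obtain ⟨φ, h1, h2, h3⟩ := hM
  obtain ⟨ψ, h4, h5, h6⟩ := hN
  refine ⟨φ + ψ, fun p hp => ?_, fun p hp => ?_, hasDigits_xor h3 h6⟩
  · rw [LinearMap.add_apply, h1 p hp, h4 p hp, add_zero]
  · rw [LinearMap.add_apply, h2 p hp, h5 p hp, add_zero]

/-- Whether all `t ∈ T` are exponents of monomials of weight greater than `w`. -/
def allAbove (W : ℕ) (T : List (List ℕ)) : Bool :=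
  T.all fun t => t.length == 5 && t.all (fun a => Nat.blt a 32) && Nat.blt W (octalWeight t)

theorem coeffSum_subst (cols m : List ℕ) (S : List (List ℕ)) :
    coeffSum S (subst cols (monomial (expo m) 1)) = (S.map fun s => pairing cols m s).sum :=
  coeffSum_apply _ _

theorem sum_map_eq_zero {α : Type} {l : List α} {f : α → ZMod 2} (h : ∀ a ∈ l, f a = 0) :
    (l.map f).sum = 0 := by
  rw [List.map_congr_left h]
  simp

theorem isFunctional_leadRow {L : List (ℕ × ℕ)} {seeds T : List (List ℕ)} {cols : List ℕ}
    (hL : SmallWt (L.map Prod.fst)) (hcols : cols.length = 5)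
    (hseeds : seeds.all (fits L) = true)
    (hT : allAbove (octal (L.map Prod.fst)) T = true)
    (hhit : killsHits 23 (seeds.map seedOf ++ T) = true) :
    IsFunctional (L.map Prod.fst) (leadRow cols L seeds) := by
  rw [List.all_eq_true] at hseeds
  have hT5 : ∀ t ∈ T, t.length = 5 ∧
      LexLt (fun i => (L.map Prod.fst).getD i 0) (wt (expo t)) := by
    intro t ht
    simp only [allAbove, List.all_eq_true, Bool.and_eq_true, beq_iff_eq, Nat.blt_eq] at hT
    obtain ⟨⟨h5, h32⟩, hlt⟩ := hT t ht
    exact ⟨h5, lexLt_of_lt_octalWeight h5 h32 hL hlt⟩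
  refine ⟨(coeffSum (seeds.map seedOf ++ T)).comp (subst cols).toLinearMap,
    fun p hp => coeffSum_eq_zero hhit (subst_mem_hitSpan cols hp), fun p hp => ?_, ?_⟩
  · have hle : PMinus 23 (L.map Prod.fst) ≤ LinearMap.ker
        ((coeffSum (seeds.map seedOf ++ T)).comp (subst cols).toLinearMap) := by
      refine Submodule.span_le.2 ?_
      rintro _ ⟨d, rfl, -, hd⟩
      rw [← expo_ofFn d] at hd ⊢
      refine (coeffSum_subst cols _ _).trans (sum_map_eq_zero fun s hs => ?_)
      rcases List.mem_append.1 hs with hs | hs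
      · obtain ⟨cs, hcs, rfl⟩ := List.mem_map.1 hs
        obtain ⟨h5, hw⟩ := mem_fam.1 (seedOf_mem_fam (hseeds cs hcs))
        refine pairing_eq_zero (by simp) h5 ?_
        rwa [show wt (expo (seedOf cs)) = _ from funext hw]
      · exact pairing_eq_zero (by simp) (hT5 s hs).1 (LexLt.trans hd (hT5 s hs).2)
    exact hle hp
  · refine Eq.mp (congrArg (HasDigits _) (List.map_congr_left fun m hm => ?_))
      (hasDigits_leadRow hcols hseeds)
    obtain ⟨h5, hw⟩ := mem_fam.1 hm
    refine Eq.trans ?_ (coeffSum_subst cols m _).symm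
    rw [List.map_append, List.sum_append, sum_map_eq_zero (l := T), add_zero, List.map_map]
    · rfl
    · intro t ht
      refine pairing_eq_zero h5 (hT5 t ht).1 ?_
      rw [show wt (expo m) = _ from funext hw]
      exact (hT5 t ht).2

theorem isFunctional_of_mem_leadRows {L : List (ℕ × ℕ)} {seeds T : List (List ℕ)}
    (hL : SmallWt (L.map Prod.fst)) (hseeds : seeds.all (fits L) = true)
    (hT : allAbove (octal (L.map Prod.fst)) T = true)
    (hhit : killsHits 23 (seeds.map seedOf ++ T) = true) (gs : List ℕ) :
    ∀ r ∈ leadRows L seeds gs, IsFunctional (L.map Prod.fst) r := by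
  intro r hr
  rw [leadRows, fold_map] at hr
  obtain ⟨g, -, rfl⟩ := List.mem_map.1 hr
  exact isFunctional_leadRow hL (length_digits 5 g) hseeds hT hhit

theorem lt_of_hasDigits {N : ℕ} {l : List (ZMod 2)} (h : HasDigits N l) {i : ℕ}
    (hi : N.testBit i = true) : i < l.length := by
  by_contra hle
  have := h i
  rw [bit, hi, List.getD_eq_default _ _ (not_lt.1 hle)] at this
  exact one_ne_zero (α := ZMod 2) (by simp at this)

theorem rankBelow_le_finrank {w : List ℕ} (h23 : Nat.ofDigits 2 w = 23)
    [Module.Finite (ZMod 2) (QPw 23 w)] {d b : ℕ} (hd : (fam w).length ≤ 2 ^ d) {rows : List ℕ}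
    (hrows : ∀ r ∈ rows, IsFunctional w r) :
    rankBelow d b rows ≤ Module.finrank (ZMod 2) (QPw 23 w) := by
  obtain ⟨H, hH, hcard⟩ := exists_leadSet_card_eq (P := IsFunctional w) (d := d) (b := b)
    (fun N hN => by
      obtain ⟨ψ, -, -, hψ⟩ := hN
      refine Nat.lt_pow_two_of_testBit N fun i hi => ?_
      by_contra hb
      have := lt_of_hasDigits hψ (Bool.not_eq_false _ ▸ hb)
      rw [List.length_map] at this
      omega) (fun _ _ => isFunctional_xor) hrows
  have hmem : ∀ s ∈ fam w, (monomial (expo s) 1 : P5) ∈ PLe 23 w := fun s hs => by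
    have := monomial_mem_PLe hs
    rwa [h23] at this
  have hlt : ∀ h ∈ H, h < (fam w).length := by
    intro h hh
    obtain ⟨-, N, ⟨ψ, -, -, hψ⟩, hN⟩ := hH h hh
    simpa using lt_of_hasDigits hψ hN.1
  let v : H → QPw 23 w := fun h => Submodule.Quotient.mk
    ⟨_, hmem _ (List.getElem_mem (hlt h h.2))⟩
  have hψ : ∀ h : H, ∃ ψ : QPw 23 w →ₗ[ZMod 2] ZMod 2, ψ (v h) = 1 ∧
      ∀ i : H, h.1 < i.1 → ψ (v i) = 0 := by
    intro h
    obtain ⟨-, N, ⟨ψ, hhit, hminus, hN⟩, hlead⟩ := hH h h.2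
    have hv : ∀ i : H, ψ (monomial (expo ((fam w).get ⟨i, hlt i i.2⟩)) 1) = bit N i := by
      intro i
      rw [hN, List.getD_eq_getElem _ _ (by simpa using hlt i i.2), List.getElem_map]
      rfl
    refine ⟨Submodule.liftQ _ (ψ.comp (PLe 23 w).subtype) fun x hx => ?_, ?_, fun i hi => ?_⟩
    · obtain ⟨y, hy, z, hz, hyz⟩ := Submodule.mem_sup.1 (Submodule.mem_comap.1 hx)
      rw [LinearMap.mem_ker, LinearMap.comp_apply, ← hyz, map_add, hhit y hy.1, hminus z hz,
        add_zero]
    · refine (hv h).trans ?_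
      simp [bit, hlead.1]
    · refine (hv i).trans ?_
      simp [bit, hlead.2 i hi]
  have hli : LinearIndependent (ZMod 2) v := by
    rw [Fintype.linearIndependent_iff]
    intro c hc
    have key : ∀ n, ∀ i : H, i.1 = n → c i = 0 := by
      intro n
      induction n using Nat.strong_induction_on with
      | _ n ih =>
        rintro i rfl
        obtain ⟨ψ, h1, h2⟩ := hψ i
        have := congrArg ψ hc
        rw [map_sum, map_zero, Finset.sum_eq_single i] at this
        · simpa [h1] using this
        · intro j _ hj
          rw [map_smul]
          rcases lt_or_gt_of_ne (fun h => hj (Subtype.ext h) : j.1 ≠ i.1) with hlt | hlt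
          · rw [ih j hlt j rfl, zero_smul]
          · rw [h2 j hlt, smul_zero]
        · simp
    exact fun i => key _ i rfl
  rw [← hcard, ← Fintype.card_coe]
  exact hli.fintype_card_le_finrank

/-- Gaussian elimination on `rows` finds `r` leading positions less than `b`. -/
structure HasRank (d b : ℕ) (rows : List ℕ) (r : ℕ) : Prop where
  beq : Nat.beq (rankBelow d b rows) r = true

theorem finrank_QPw_eq {L : List (ℕ × ℕ)} {seeds T : List (List ℕ)} {gs : List ℕ}
    {ts : List (ℕ × List ℕ)} {W r n : ℕ} (hlen : L.length ≤ 4)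
    (h23 : Nat.ofDigits 2 (L.map Prod.fst) = 23) (hL : ∀ a ∈ L.map Prod.fst, a < 8)
    (hW : octal (L.map Prod.fst) = W) (hsize : (fam (L.map Prod.fst)).length = n + r)
    (hn : n + r ≤ 8192) (hseeds : seeds.all (fits L) = true) (hT : allAbove W T = true)
    (hhit : killsHits 23 (seeds.map seedOf ++ T) = true)
    (hr : HasRank 17 65536 (hitRows W ts) r)
    (hlead : HasRank 13 8192 (leadRows L seeds gs) n) :
    Module.finrank (ZMod 2) (QPw 23 (L.map Prod.fst)) = n := by
  subst hW
  have hw : SmallWt (L.map Prod.fst) := ⟨by rw [List.length_map]; omega, hL⟩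
  obtain ⟨hfin, hle⟩ := finrank_QPw_add_rankBelow_le (w := L.map Prod.fst)
    (by rwa [List.length_map]) h23 (isRel_of_mem_hitRows hw ts)
  have hge := rankBelow_le_finrank (d := 13) (b := 8192) h23 (by omega)
    (isFunctional_of_mem_leadRows hw hseeds hT hhit gs)
  rw [Nat.eq_of_beq_eq_true hr.beq] at hle
  rw [Nat.eq_of_beq_eq_true hlead.beq] at hge
  omega

/-- Squares yielding a basis of the relations in weight `[3, 2, 2, 1]`. -/
def squares3221 : List (ℕ × List ℕ) :=
  [(1, [4, 1, 2, 1]), (2, [3, 3, 1, 1]), (2, [3, 3, 3]), (4, [3, 2, 3]), (4, [3, 4, 2]), (1, [4,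
  3, 1, 1])]

/-- The entries of `[3, 2, 2, 1]` with the numbers of monomials of the remaining weights. -/
def levels3221 : List (ℕ × ℕ) := [(3, 500), (2, 50), (2, 5), (1, 1)]

/-- Monomials of weight `[3, 2, 2, 1]` whose coefficients enter a functional vanishing on hits. -/
def seeds3221 : List (List ℕ) :=
  [[11, 12, 12, 8], [14, 9, 12, 8], [14, 12, 9, 8]]

/-- Monomials of greater weight whose coefficients enter the same functional. -/
def above3221 : List (List ℕ) :=
  [[3, 2, 3, 15, 0]]

/-- Substitutions, in base `32`, yielding independent functionals in weight `[3, 2, 2, 1]`. -/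
def substs3221 : List ℕ :=
  [197057, 12588034, 9437253, 13350, 8389638, 72717, 6187, 296967, 1048776, 7667776, 8388834,
  12779552, 2276352, 229421, 7341312, 8393792, 1278208, 393409, 41152, 241696, 1062919, 2364416,
  14909442, 2107616, 2102560, 5243362, 2261000, 12648453, 237570, 5308426, 71008, 2392069,
  5570562, 393285, 268320, 65893, 5308672, 65768, 366593, 10551456, 12813312, 5572608, 1226,
  11536544, 8418, 12653568, 7341067, 7340104, 5254146, 165899, 6433, 296128, 1054728, 6299680,
  5316608, 1310944, 230688, 2097541, 73733, 3276814, 494596, 7634948, 3145867, 7737344, 3396,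
  4328, 4209667, 7344142, 106500, 67911, 229513, 98564, 3146020, 105482, 10467, 13729799,
  3408000, 4292928, 4197760, 10715232, 4433920, 299104, 12583015, 10489859, 139488, 12685312,
  8392800, 262244, 105728, 7352448, 11536420, 1052746, 361602, 1050760, 35300, 10520580, 69889,
  2228266, 1118216, 4239362, 2101505, 2130058, 141377, 2360448, 4457536, 1057860, 1053058,
  66948, 2105473, 264321, 43076, 4260193, 2229262, 4522018, 8389762, 4202530, 36937, 1343556,
  37154, 13632580, 4196393, 1312772, 263236, 331841, 1122432, 1114372, 9570336, 69677, 4235328,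
  42114, 2130180, 1057922, 2101293, 8458241, 4458497, 2556033, 4259884, 2134024, 4229135,
  2556932, 1118464, 4196833, 2138116, 1179725, 8454180, 2237472, 10518658, 133473, 1179938,
  2134272, 8390785, 1050884, 11567172, 1182016, 329764, 2098436, 73764, 133161, 1181704,
  8454273, 9570305, 8392738, 1187904, 4229568, 34956, 1507458, 1187842, 1347586, 2098316,
  2138240, 10552448, 1380416, 11600900, 12617856, 2229504, 2359332, 5605504, 70796, 1123334,
  2105508, 1114312, 8585250, 12750912, 13799426, 2462721, 3287041, 1127553, 2229633, 12686368,
  6754336, 140322, 4524064, 4206657, 4620353, 4490242, 4271105, 4195586, 4195400, 132418,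
  4227144, 8392769, 132169, 8520768, 4268064, 299042, 5309696, 6358024, 15959042, 4293026,
  11524, 426122, 13729802, 12431, 14689284, 269324, 8388995, 14094336, 262469, 4555008, 237577,
  13631626, 4207626, 108992, 12681472, 426275, 372864, 13636032, 273415, 4467712, 6586376,
  7340297, 16089312, 8399072, 12779533, 8388809, 9634881, 8425, 4202848, 4521993, 14090244,
  5386, 9442315, 8391692, 146440, 9582592, 7436, 10755072, 229773, 10748064, 6300680, 131370,
  407712, 6300928, 4194730, 7733696, 335879, 5515264, 12592224, 363968, 1310796, 263554,
  2371585, 8458276, 4327745, 2491648, 8520772, 2232641, 41346, 2238593, 8390700, 1444096,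
  2232365, 2523177, 4621380, 2109480, 4458532, 2359681, 1187908, 12845090, 1126408, 4270116,
  78081, 4264417, 13666592, 395304, 14813313, 401473, 1061122, 35208, 1323072, 8433666, 73772,
  1118348, 4231242, 2109697, 2458756, 1114504, 2405408, 2491400, 12847136, 8390018, 9831426,
  13708320, 1128704, 12617737, 8454189, 13642817, 8461568, 7413768, 8593409, 5251144, 14713287,
  9439525, 2104683, 7610400, 7381248, 6553857, 8655936, 230763, 7342344, 5703694, 1448320,
  400769, 8650823, 5254498, 8429574, 2334728, 264453, 8650945, 77157, 16221190, 7602248, 245217,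
  12749184, 8394792, 7373130, 1258912, 72968, 1442028, 2367495, 267336, 1056968, 238665,
  3155021, 3189184, 3606536, 3549186, 8392994, 132424, 4665376, 9502980, 8720385, 2392200,
  41284, 10497249, 2396416, 8519722, 8431744, 11571488, 407681, 15074308, 8392777, 1509698,
  8528898, 37130, 4489288, 8454281, 142658, 9699458, 12596292, 1310858, 8463364, 4204584,
  8716324, 1063052, 332033, 10749056, 1321088, 335908, 8392746, 263306, 78244, 7844866, 2101513,
  8519970, 4457482, 8720416, 4269064, 1442244, 303234, 4260136, 266282, 1413129, 9576512,
  4195821, 4601857, 10526724, 8521737, 4202817, 4522338, 142377, 8463488, 8529952, 4237568,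
  8390793, 2106628, 11604288, 8389770, 394692, 9701380, 10625025, 428168, 2106508, 2404480,
  9472482, 2404356, 12716320, 2396172, 13762632, 8814660, 2141261, 75919, 4456552, 15073441,
  10557451, 4202600, 142443, 6588672, 265352, 3513355, 4301833, 4197772, 10489159, 7351652,
  9705536, 462276, 3179912, 8527875, 8523008, 11544770, 8657924, 5247242, 301314, 5439917,
  11644032, 8552772, 9439556, 12595331, 7678048, 13632964, 3277262, 4435296, 14782478, 144803,
  10813667, 8689666, 12681604, 232712, 8552586, 8391816, 11542657, 4522311, 42187, 2272266,
  1061318, 366664, 70952, 10650912, 8520718, 14716936, 1053004, 10617217, 2196814, 1118472,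
  2400324, 4239746, 4235336, 2360456, 1443980, 11571554, 4588930, 2498848, 2363432, 4229417,
  2523432, 2570276, 8521985, 2425323, 2134280, 2139428, 9479236, 2236456, 13677698, 1454210,
  12594212, 10726720, 306307, 8687712, 3408164, 10616939, 2361700, 12588385, 1356806, 1517576,
  5638532, 1420358, 2262346, 7672064, 2269320, 12618118, 15177856, 5322894, 5607499, 10552456,
  12728385, 10752065, 4458537, 4558080, 8520778, 8458529, 8423561, 11804676, 3342602, 8425546,
  11601188, 2363681, 4665409, 2368641, 1188162, 10555432, 9544833, 11897986, 1255496, 7473482,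
  5511426, 12983364, 13777280, 8686721, 2532641, 2495748, 11841544, 8849572, 1253764, 8628260,
  395521, 15729739, 274466, 8455552, 8468481, 12625984, 13993024, 361549, 9928769, 8404002,
  9866241, 10489281, 13729866, 8487949, 4620335, 4202569, 4465666, 133416, 15795489, 5638400,
  6307266, 5570817, 146508, 5285896, 139617, 6370688, 4524041, 5571840, 6324490, 15055936,
  7342345, 12877896, 13639753, 13705228, 303490, 13639970, 8817024, 8816652, 6586633, 7610377,
  269608, 5253386, 14924815, 9666824, 178636, 6586632, 7676160, 206088, 9443624, 7353740,
  5516352, 10494337, 12584202, 15008001, 14954497, 15737901, 8716737, 12918785, 10518926,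
  1059086, 10880256, 6365224, 7481352, 8586498, 9515328, 436302, 7349578, 397676, 11927939,
  7602536, 4269313, 504196, 7780768, 14090381, 11938819, 309385, 16064520, 14689572, 3423247,
  3547392, 10788128, 12716078, 139624, 9905280, 11673856, 14909774, 12714347, 12586376, 8626560,
  10630154, 146828, 368776, 11541999, 8528930, 8847403, 6595625, 7603464, 2262510, 12592233,
  8431748, 14028868, 2492841, 8523849, 12661892, 5746691, 4457796, 10752036, 4335691, 1446030,
  4335970, 4622476, 8522020, 4231496, 12652964, 13893736, 8458377, 4458916, 4268173, 10979460,
  4501634, 2372740, 8393065, 9568584, 4562953, 4653484, 337156, 4204843, 368964, 13636078,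
  10784776, 4562978, 9516321, 9472429, 10561985, 10954786, 2604075, 14723150, 12722210,
  15999233, 1450242, 1118633, 1313036, 1386946, 2524457, 2599979, 2494721, 8794177, 12656897,
  8466472, 332207, 9896075, 7735713, 5710144, 5255567, 6328584, 3412104, 8653956, 11666573,
  9474532, 1453102, 12879916, 12913025, 2404641, 9832833, 1421569, 14856608, 5515616, 1126665,
  8815692, 2265384, 8527945, 1321220, 10527044, 8652100, 2494861, 3483972, 4274670, 4465922,
  10752321, 2239850, 4490539, 4242861, 1188170, 8495364, 4700238, 12716460, 4497481, 9507081,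
  7606536, 8687688, 10756132, 16201858, 4491528, 13765004, 7446792, 1380616, 274893, 10912009,
  1444168, 6435108, 3223820, 13739081, 3219852, 3541256, 10630156, 2396556, 8818765, 5579016,
  14035200, 5516449, 2428300, 3319854, 8823814, 8685769, 5580936, 9509128, 14138529, 14062735,
  5384520, 14061614, 8465547, 11673640, 11903105, 11608324, 8588552, 2276814, 10630221,
  10626402, 8753194, 4636097, 8529249, 9769218, 5519438, 2567662, 1480174, 2404620, 8661092,
  8521166, 11864516, 10749068, 6698125, 8691846, 4531305, 11841576, 2236768, 2566159, 8627208,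
  8880418, 11547937, 272430, 14952480, 336257, 15081504, 13960200, 13646244, 9732420, 10912776,
  13639722, 3408140, 1127812, 394607, 10880480, 6567168, 8847405, 4210061, 4565000, 8653185,
  12857409, 9479245, 15017026, 3289475, 14786880, 13901858, 12625186, 1388866, 3420480,
  15173674, 10860609, 15008847, 14820365, 10752257, 10627112, 2435211, 8687874, 8530241,
  4271434, 4557131, 8658056, 10945794, 3187084, 12953728, 10785152, 7676234, 13743144, 8553800,
  6721577, 4499498, 1256745, 4530529, 8467852, 12886088, 2567498, 11995631, 16091467, 15868040,
  5571881, 9643330, 12684552, 15802788, 1424877, 9483695, 5507466, 10556808, 5612586, 1325198,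
  10914862, 14131617, 8620490, 6405551, 4636111, 4635020, 9518411, 10951975, 3645703, 2400684,
  15077665, 7678433, 15012129, 9582990, 14955649, 16065697, 6599076, 1188192, 14036998, 2110762,
  1420523, 8520011, 8422734, 6332681, 11968521, 2566188, 12592394, 6629738, 10979690, 14094798,
  10724649, 10887425, 4666756, 12914728, 14717196, 1549740, 1356271, 9582635, 14091627,
  10753289, 3488008, 8564074, 5650927, 14100833, 11571464, 3551627, 12918824, 13937705, 3489263,
  14067758, 8655107, 8660036, 8429892, 8721672, 8657192, 15154630, 10756359, 12988653, 12761228,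
  5509386, 8659246, 11873514, 13679758, 8717704, 16221611, 4334920]

theorem rank_hitRows3221 :
    HasRank 17 65536 (hitRows 13448 squares3221) 4075 :=
  ⟨by decide +kernel⟩

theorem rank_leadRows3221 :
    HasRank 13 8192 (leadRows levels3221 seeds3221 substs3221) 925 :=
  ⟨by decide +kernel⟩

theorem finrank_QPw3221 : Module.finrank (ZMod 2) (QPw 23 [3, 2, 2, 1]) = 925 :=
  finrank_QPw_eq (L := levels3221) (seeds := seeds3221) (T := above3221) (by decide) (by decide)
    (by decide) (by decide +kernel) (by decide +kernel) (by norm_num) (by decide +kernel)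
    (by decide +kernel) (by decide +kernel) rank_hitRows3221 rank_leadRows3221

/-- Squares yielding a basis of the relations in weight `[3, 4, 1, 1]`. -/
def squares3411 : List (ℕ × List ℕ) :=
  [(1, [4, 3, 1, 1]), (1, [4, 5, 0, 1]), (2, [3, 5, 0, 1]), (4, [3, 4, 2])]

/-- The entries of `[3, 4, 1, 1]` with the numbers of monomials of the remaining weights. -/
def levels3411 : List (ℕ × ℕ) := [(3, 125), (4, 25), (1, 5), (1, 1)]

/-- Monomials of weight `[3, 4, 1, 1]` whose coefficients enter a functional vanishing on hits. -/
def seeds3411 : List (List ℕ) :=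
  [[19, 30, 2, 4], [19, 30, 4, 2], [21, 30, 2, 2], [22, 27, 2, 4], [26, 23, 2, 4], [22, 27, 4,
  2], [26, 23, 4, 2], [22, 29, 2, 2], [28, 23, 2, 2]]

/-- Monomials of greater weight whose coefficients enter the same functional. -/
def above3411 : List (List ℕ) :=
  [[1, 7, 7, 2, 6], [2, 7, 7, 1, 6], [2, 7, 7, 2, 5], [1, 7, 9, 1, 5], [1, 11, 5, 1, 5], [1, 13,
  3, 1, 5], [1, 7, 11, 1, 3]]

/-- Substitutions, in base `32`, yielding independent functionals in weight `[3, 4, 1, 1]`. -/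
def substs3411 : List ℕ :=
  [13410409, 16910376, 25207939, 11812909, 17204296, 3555617, 2237992, 9494923, 18122788,
  9998602, 4491536, 1648164, 1325826, 14820625, 8521486, 25487521, 8831433, 2565640, 26486340,
  25431241, 14779665, 10077228, 4857890, 26944548, 21020931, 1216136, 8914268, 5830945,
  22319138, 27583526, 11833861, 9045134, 18209033, 18222856, 8449681, 8772657, 8524889,
  22482985, 13118209, 18554945, 14721648, 9310401, 25313339, 7749793, 9249922, 16984345,
  4829697, 14992131, 23653665, 20222305, 14762753, 29635660, 13025380, 19138606, 7620961,
  26625360, 9280805, 4230430, 21176363, 1779180, 1752169, 3680417, 3621192, 16882857, 21768451,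
  22963746, 17277025, 27800833, 6340876, 8474680, 11685928, 8444805, 4523440, 6572553, 6579352,
  13222180, 31917384, 26951717, 31909132, 4442401, 18000961, 17863010, 4721736, 18175880,
  10239052, 3414160, 27616516, 6571492, 2796321, 1378708, 19276113, 19147938, 25247844,
  23306564, 27853892, 12564900, 29241601, 14725656, 21104002, 18159713, 16816234, 16818917,
  18668713, 15566641, 18065675]

theorem rank_hitRows3411 :
    HasRank 17 65536 (hitRows 14408 squares3411) 1145 :=
  ⟨by decide +kernel⟩

theorem rank_leadRows3411 :
    HasRank 13 8192 (leadRows levels3411 seeds3411 substs3411) 105 :=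
  ⟨by decide +kernel⟩

theorem finrank_QPw3411 : Module.finrank (ZMod 2) (QPw 23 [3, 4, 1, 1]) = 105 :=
  finrank_QPw_eq (L := levels3411) (seeds := seeds3411) (T := above3411) (by decide) (by decide)
    (by decide) (by decide +kernel) (by decide +kernel) (by norm_num) (by decide +kernel)
    (by decide +kernel) (by decide +kernel) rank_hitRows3411 rank_leadRows3411

/-- Squares yielding a basis of the relations in weight `[3, 4, 3]`. -/
def squares343 : List (ℕ × List ℕ) :=
  [(1, [4, 3, 3]), (1, [4, 5, 2]), (2, [3, 5, 2])]

/-- The entries of `[3, 4, 3]` with the numbers of monomials of the remaining weights. -/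
def levels343 : List (ℕ × ℕ) := [(3, 50), (4, 10), (3, 1)]

/-- Monomials of weight `[3, 4, 3]` whose coefficients enter a functional vanishing on hits. -/
def seeds343 : List (List ℕ) :=
  [[19, 30, 28], [21, 30, 26], [25, 30, 22], [22, 27, 28], [26, 23, 28], [22, 29, 26], [26, 29,
  22], [28, 23, 26], [28, 27, 22]]

/-- Monomials of greater weight whose coefficients enter the same functional. -/
def above343 : List (List ℕ) :=
  [[1, 3, 3, 9, 7], [1, 3, 9, 3, 7], [1, 9, 3, 3, 7], [1, 5, 3, 7, 7], [1, 5, 7, 3, 7], [1, 7,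
  5, 3, 7], [1, 5, 5, 5, 7]]

/-- Substitutions, in base `32`, yielding independent functionals in weight `[3, 4, 3]`. -/
def substs343 : List ℕ :=
  [16290855, 8522803, 26252714, 27528321, 14734531, 1315331, 12619866, 9518689, 4411713,
  14170241, 1716418, 14943344, 14721741, 16909739, 1196105, 4538406, 4982220, 6391628, 1315921,
  32780331, 4760067, 14787186, 23830666, 17024073]

theorem rank_hitRows343 :
    HasRank 17 65536 (hitRows 14528 squares343) 476 :=
  ⟨by decide +kernel⟩

theorem rank_leadRows343 :
    HasRank 13 8192 (leadRows levels343 seeds343 substs343) 24 :=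
  ⟨by decide +kernel⟩

theorem finrank_QPw343 : Module.finrank (ZMod 2) (QPw 23 [3, 4, 3]) = 24 :=
  finrank_QPw_eq (L := levels343) (seeds := seeds343) (T := above343) (by decide) (by decide)
    (by decide) (by decide +kernel) (by decide +kernel) (by norm_num) (by decide +kernel)
    (by decide +kernel) (by decide +kernel) rank_hitRows343 rank_leadRows343

/-- `dim QP_5((3,2,2,1)) = 925`, `dim QP_5((3,4,1,1)) = 105`, `dim QP_5((3,4,3)) = 24`. -/
theorem stmt14 :
    Module.finrank (ZMod 2) (QPw 23 [3, 2, 2, 1]) = 925 ∧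
    Module.finrank (ZMod 2) (QPw 23 [3, 4, 1, 1]) = 105 ∧
    Module.finrank (ZMod 2) (QPw 23 [3, 4, 3]) = 24 :=
  ⟨finrank_QPw3221, finrank_QPw3411, finrank_QPw343⟩
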